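/- arXiv:2305.00563 — 4 statements merged into one kernel-verified Lean document; each statement's English description precedes it below -/
import Mathlib

section
/- (Theorem 5) For every real u ≥ 4, setting y = 1/(u−2), the Furry probability of weight four satisfies P_4(u) = P_3(u−1)·log(u) + (ζ(2)/4)·(2·Li_2(1 − 1/u) + log²(u)) − E_4(y) − H_4(y). -/
/-- The classical polylogarithm `Li_k(z) = ∑_{n≥1} z^n/n^k`. -/
noncomputable def Li (k : ℕ) (z : ℝ) : ℝ :=
  ∑' n : ℕ, z ^ (n + 1) / ((n : ℝ) + 1) ^ k

/-- `ζ_k = Li_k(1)`. -/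
noncomputable def zeta' (k : ℕ) : ℝ := Li k 1

/-- The easy part `E₄(y)` at weight four. -/
noncomputable def E4 (y : ℝ) : ℝ :=
  (19 / 16) * zeta' 4 - 3 * Li 4 (-y) + 3 * Li 3 (-y) * Real.log y
    - (3 / 2) * Li 2 (-y) * (Real.log y) ^ 2
    + (1 / 2) * Li 1 (-y) * (Real.log y) ^ 3
    + (1 / 8) * (Real.log y) ^ 4

/-- The hard integral `H₄(y)` at weight four. -/
noncomputable def H4 (y : ℝ) : ℝ :=
  ∫ x in (0 : ℝ)..y,
    (Real.log (x / (1 + 2 * x)) * Li 2 x + (1 / 2) * (Real.log x) ^ 2 * Li 1 (-2 * x))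
      / (x * (1 + x))

section
open Real Set Filter Topology MeasureTheory

lemma fy_const {f : ℝ → ℝ} {a b : ℝ} (hab : a ≤ b) (hc : ContinuousOn f (Icc a b))
    (hd : ∀ x ∈ Ioo a b, HasDerivAt f 0 x) : f b = f a := by
  rcases hab.eq_or_lt with rfl | h
  · rfl
  · obtain ⟨c, _, h2⟩ := exists_hasDerivAt_eq_slope f (fun _ => 0) h hc hd
    have : b - a ≠ 0 := by linarith
    field_simp at h2
    linarith

lemma fy_term_bound (k : ℕ) (z : ℝ) (n : ℕ) :
    ‖z ^ (n + 1) / ((n : ℝ) + 1) ^ k‖ ≤ |z| ^ (n + 1) := by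
  have h1 : (1:ℝ) ≤ ((n : ℝ) + 1) ^ k := one_le_pow₀ (by linarith [(Nat.cast_nonneg n : (0:ℝ) ≤ n)])
  rw [norm_div, norm_pow, Real.norm_eq_abs, Real.norm_eq_abs, abs_of_pos (by linarith : (0:ℝ) < ((n : ℝ) + 1) ^ k)]
  exact div_le_self (by positivity) h1

lemma fy_geom {r : ℝ} (h0 : 0 ≤ r) (h1 : r < 1) : Summable (fun n : ℕ => r ^ (n + 1)) :=
  (summable_nat_add_iff 1).2 (summable_geometric_of_lt_one h0 h1)

lemma fy_geom_sum {r : ℝ} (h0 : |r| < 1) : HasSum (fun n : ℕ => r ^ (n + 1)) (r / (1 - r)) := by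
  have := (hasSum_geometric_of_abs_lt_one h0).mul_left r
  convert! this using 1
  funext n; ring

lemma fy_Li_summable (k : ℕ) {z : ℝ} (hz : |z| < 1) :
    Summable (fun n : ℕ => z ^ (n + 1) / ((n : ℝ) + 1) ^ k) :=
  Summable.of_norm_bounded (fy_geom (abs_nonneg z) hz) (fy_term_bound k z)

lemma fy_Li0 {z : ℝ} (hz : |z| < 1) : Li 0 z = z / (1 - z) := by
  unfold Li
  simpa using (fy_geom_sum hz).tsum_eq

lemma fy_Li1 {z : ℝ} (hz : |z| < 1) : Li 1 z = -Real.log (1 - z) := by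
  unfold Li
  simpa using (Real.hasSum_pow_div_log_of_abs_lt_one hz).tsum_eq

lemma fy_Li_zero (k : ℕ) : Li k 0 = 0 := by
  unfold Li; simp

lemma fy_Li_bound (k : ℕ) {z : ℝ} (hz : |z| ≤ 1 / 2) : |Li k z| ≤ 2 * |z| := by
  have h1 : |(|z|)| < 1 := by rw [abs_abs]; linarith
  have h := tsum_of_norm_bounded (fy_geom_sum h1) (fy_term_bound k z)
  rw [Real.norm_eq_abs] at h
  refine h.trans ?_
  rw [div_le_iff₀ (by linarith)]
  nlinarith [abs_nonneg z]

lemma fy_Li_cont (k : ℕ) (hk : 2 ≤ k) : ContinuousOn (Li k) (Icc (-1) 1) := by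
  have hs : Summable (fun n : ℕ => 1 / ((n : ℝ) + 1) ^ k) := by
    have := (summable_nat_add_iff 1).2 (Real.summable_one_div_nat_pow.2 (by omega : 1 < k))
    simpa using this
  unfold Li
  refine continuousOn_tsum (fun n => by fun_prop) hs ?_
  intro n x hx
  have : |x| ≤ 1 := abs_le.2 hx
  rw [norm_div, norm_pow, Real.norm_eq_abs, Real.norm_eq_abs,
    abs_of_pos (by positivity : (0:ℝ) < ((n : ℝ) + 1) ^ k)]
  gcongr
  exact pow_le_one₀ (abs_nonneg x) this

lemma fy_Li_deriv (k : ℕ) {z : ℝ} (hz : |z| < 1) (hz0 : z ≠ 0) :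
    HasDerivAt (Li (k + 1)) (Li k z / z) z := by
  obtain ⟨r, hr1, hr2⟩ := exists_between hz
  have hr0 : 0 ≤ r := (abs_nonneg z).trans hr1.le
  have hu : Summable (fun n : ℕ => r ^ n) := summable_geometric_of_lt_one hr0 hr2
  have key := hasDerivAt_tsum_of_isPreconnected (t := Ioo (-r) r)
    (g := fun (n : ℕ) (y : ℝ) => y ^ (n + 1) / ((n : ℝ) + 1) ^ (k + 1))
    (g' := fun (n : ℕ) (y : ℝ) => y ^ n / ((n : ℝ) + 1) ^ k) (y₀ := 0) (y := z) hu isOpen_Ioo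
    isPreconnected_Ioo ?_ ?_ ?_ ?_ ?_
  · unfold Li
    convert! key using 1
    rw [← tsum_div_const]
    congr 1
    funext n
    field_simp
    ring
  · intro n y hy
    have hn : ((n : ℝ) + 1) ≠ 0 := by positivity
    have := (hasDerivAt_pow (n + 1) y).div_const (((n : ℝ) + 1) ^ (k + 1))
    convert! this using 1
    push_cast
    field_simp
    ring
  · intro n y hy
    have h1 : (1:ℝ) ≤ ((n : ℝ) + 1) ^ k :=
      one_le_pow₀ (by linarith [(Nat.cast_nonneg n : (0:ℝ) ≤ n)])
    rw [norm_div, norm_pow, Real.norm_eq_abs, Real.norm_eq_abs,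
      abs_of_pos (by linarith : (0:ℝ) < ((n : ℝ) + 1) ^ k)]
    refine (div_le_self (by positivity) h1).trans ?_
    exact pow_le_pow_left₀ (abs_nonneg y) (abs_le.2 ⟨hy.1.le, hy.2.le⟩) n
  · constructor
    · have := abs_nonneg z; linarith
    · have := abs_nonneg z; linarith
  · simp
  · exact abs_lt.1 hr1

lemma fy_zeta_two : zeta' 2 = π ^ 2 / 6 := by
  have h := (hasSum_nat_add_iff' 1).2 hasSum_zeta_two
  unfold zeta' Li
  simpa using h.tsum_eq

lemma fy_zeta_four : zeta' 4 = π ^ 4 / 90 := by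
  have h := (hasSum_nat_add_iff' 1).2 hasSum_zeta_four
  unfold zeta' Li
  simpa using h.tsum_eq

lemma fy_zeta_sq : zeta' 2 ^ 2 = 5 / 2 * zeta' 4 := by
  rw [fy_zeta_two, fy_zeta_four]; ring

lemma fy_Li4_neg_one : Li 4 (-1) = -(7 / 8) * zeta' 4 := by
  have hs : HasSum (fun n : ℕ => 1 / ((n : ℝ) + 1) ^ 4) (zeta' 4) := by
    rw [fy_zeta_four]
    have h := (hasSum_nat_add_iff' 1).2 hasSum_zeta_four
    simpa using h
  have hsum := hs.summable
  -- odd-index terms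
  have hodd : HasSum (fun n : ℕ => 1 / (((2 * n + 1 : ℕ) : ℝ) + 1) ^ 4) (zeta' 4 / 16) := by
    have := hs.div_const 16
    convert! this using 1
    funext n; push_cast
    have : ((n:ℝ) + 1) ≠ 0 := by positivity
    have : (2 * (n:ℝ) + 1 + 1) = 2 * (n + 1) := by ring
    rw [this]; field_simp; norm_num
  have heven : Summable (fun n : ℕ => 1 / (((2 * n : ℕ) : ℝ) + 1) ^ 4) :=
    hsum.comp_injective (i := fun n : ℕ => 2 * n) (fun a b h => by simpa using h)
  obtain ⟨e, he⟩ := heven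
  have h1 : zeta' 4 = e + zeta' 4 / 16 :=
    hs.unique (HasSum.even_add_odd (f := fun n : ℕ => 1 / ((n : ℝ) + 1) ^ 4) he hodd)
  have h2 : HasSum (fun n : ℕ => (-1 : ℝ) ^ (n + 1) / ((n : ℝ) + 1) ^ 4) (-e + zeta' 4 / 16) := by
    refine HasSum.even_add_odd ?_ ?_
    · convert! he.neg using 1
      funext n
      rw [pow_succ, pow_mul]; norm_num; ring
    · convert! hodd using 1
      funext n
      rw [show 2 * n + 1 + 1 = 2 * (n + 1) by ring, pow_mul]; norm_num
  unfold Li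
  rw [h2.tsum_eq]
  linarith


lemma fy_log_bound {t : ℝ} (h0 : 0 ≤ t) (h1 : t ≤ 1 / 2) : |Real.log (1 - t)| ≤ 2 * t := by
  have h2 : |t| ≤ 1 / 2 := by rwa [abs_of_nonneg h0]
  have := fy_Li_bound 1 h2
  rw [fy_Li1 (by linarith), abs_neg, abs_of_nonneg h0] at this
  exact this

lemma fy_Li2_deriv {z : ℝ} (hz : |z| < 1) (hz0 : z ≠ 0) :
    HasDerivAt (Li 2) (-Real.log (1 - z) / z) z := by
  have := fy_Li_deriv 1 hz hz0
  rwa [fy_Li1 hz] at this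

lemma fy_tl0 (m : ℕ) : Tendsto (fun t : ℝ => |Real.log t| ^ m * t) (𝓝[>] 0) (𝓝 0) := by
  have h := (isLittleO_pow_log_id_atTop (n := m)).tendsto_div_nhds_zero
  have h2 := (h.comp tendsto_inv_nhdsGT_zero).abs
  rw [abs_zero] at h2
  refine h2.congr' ?_
  filter_upwards [self_mem_nhdsWithin] with t ht
  have ht' : 0 < t := ht
  simp only [Function.comp, id, Real.log_inv, abs_div, abs_pow, abs_neg, abs_inv, abs_of_pos ht']
  rw [div_inv_eq_mul]

lemma fy_tl (m : ℕ) (g : ℝ → ℝ) (C : ℝ) (hg : ∀ᶠ t in 𝓝[>] (0:ℝ), |g t| ≤ C * t) :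
    Tendsto (fun t : ℝ => Real.log t ^ m * g t) (𝓝[>] 0) (𝓝 0) := by
  refine squeeze_zero_norm' (a := fun t => C * (|Real.log t| ^ m * t)) ?_ ?_
  · filter_upwards [hg] with t ht
    rw [norm_mul, norm_pow, Real.norm_eq_abs, Real.norm_eq_abs]
    nlinarith [pow_nonneg (abs_nonneg (Real.log t)) m]
  · simpa using (fy_tl0 m).const_mul C

lemma fy_ev (b : ℝ) (hb : 0 < b) : ∀ᶠ t in 𝓝[>] (0:ℝ), 0 < t ∧ t < b :=
  Ioo_mem_nhdsGT hb

lemma fy_log_pow_bound (k : ℕ) : ∀ᶠ t in 𝓝[>] (0:ℝ), |Real.log (1 - t) ^ (k + 1)| ≤ 2 * t := by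
  filter_upwards [fy_ev (1/2) (by norm_num)] with t ht
  have h := fy_log_bound ht.1.le ht.2.le
  rw [abs_pow, pow_succ]
  have : |Real.log (1 - t)| ^ k ≤ 1 := pow_le_one₀ (abs_nonneg _) (by linarith)
  calc _ ≤ 1 * |Real.log (1 - t)| := by gcongr
    _ ≤ _ := by linarith

lemma fy_one_sub : Tendsto (fun t : ℝ => 1 - t) (𝓝[>] 0) (𝓝[Icc (-1) 1] 1) := by
  rw [tendsto_nhdsWithin_iff]
  constructor
  · have : Tendsto (fun t : ℝ => 1 - t) (𝓝 0) (𝓝 (1 - 0)) := by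
      apply Continuous.tendsto; fun_prop
    rw [sub_zero] at this
    exact this.mono_left nhdsWithin_le_nhds
  · filter_upwards [fy_ev 1 (by norm_num)] with t ht
    constructor <;> linarith [ht.1, ht.2]

lemma fy_Li_one_tendsto (k : ℕ) (hk : 2 ≤ k) :
    Tendsto (fun t : ℝ => Li k (1 - t)) (𝓝[>] 0) (𝓝 (zeta' k)) :=
  ((fy_Li_cont k hk) 1 (by norm_num)).tendsto.comp fy_one_sub

lemma fy_Li_refl {x : ℝ} (h0 : 0 < x) (h1 : x < 1) :
    Li 2 x + Li 2 (1 - x) + Real.log x * Real.log (1 - x) = zeta' 2 := by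
  set f : ℝ → ℝ := fun x => Li 2 x + Li 2 (1 - x) + Real.log x * Real.log (1 - x) with hf
  have hd : ∀ z, 0 < z → z < 1 → HasDerivAt f 0 z := by
    intro z hz0 hz1
    have e1 := fy_Li2_deriv (z := z) (by rw [abs_of_pos hz0]; exact hz1) hz0.ne'
    have hs : HasDerivAt (fun z : ℝ => 1 - z) (-1) z := by
      simpa using (hasDerivAt_id z).const_sub 1
    have e2 := (fy_Li2_deriv (z := 1 - z) (by rw [abs_of_pos (by linarith)]; linarith)
      (by linarith)).comp z hs
    have e3 := (Real.hasDerivAt_log hz0.ne').mul (hs.log (by linarith))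
    have := (e1.add e2).add e3
    convert! this using 1
    have : 1 - z ≠ 0 := by linarith
    rw [show 1 - (1 - z) = z by ring]
    field_simp
    ring
  have hconst : ∀ t ∈ Ioo 0 x, f x = f t := by
    intro t ht
    refine fy_const ht.2.le ?_ ?_
    · intro z hz
      exact (hd z (by linarith [ht.1, hz.1]) (by linarith [hz.2])).continuousAt.continuousWithinAt
    · intro z hz
      exact hd z (by linarith [ht.1, hz.1]) (by linarith [hz.2])
  have hlim : Tendsto f (𝓝[>] 0) (𝓝 (zeta' 2)) := by
    have l1 : Tendsto (Li 2) (𝓝[>] 0) (𝓝 0) := by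
      have := ((fy_Li_cont 2 le_rfl) 0 (by norm_num)).tendsto
      rw [fy_Li_zero] at this
      refine this.mono_left ?_
      refine nhdsWithin_le_of_mem ?_
      filter_upwards [fy_ev 1 (by norm_num)] with t ht
      constructor <;> linarith [ht.1, ht.2]
    have l3 := fy_tl 1 _ 2 (fy_log_pow_bound 0)
    have := (l1.add (fy_Li_one_tendsto 2 le_rfl)).add l3
    simpa [hf] using this
  refine tendsto_nhds_unique (tendsto_const_nhds (x := f x) |>.congr' ?_) hlim
  filter_upwards [fy_ev x h0] with t ht
  exact hconst t ht

/-- antiderivative of log^3 s/(1-s) -/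
noncomputable def fyN (s : ℝ) : ℝ :=
  -Real.log (1 - s) * Real.log s ^ 3 - 3 * Li 2 s * Real.log s ^ 2 + 6 * Li 3 s * Real.log s
    - 6 * Li 4 s

/-- antiderivative of log^3 w/(1+w) -/
noncomputable def fyM (w : ℝ) : ℝ :=
  Real.log (1 + w) * Real.log w ^ 3 + 3 * Li 2 (-w) * Real.log w ^ 2 - 6 * Li 3 (-w) * Real.log w
    + 6 * Li 4 (-w)

lemma fyN_deriv {s : ℝ} (h0 : 0 < s) (h1 : s < 1) :
    HasDerivAt fyN (Real.log s ^ 3 / (1 - s)) s := by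
  have ha : |s| < 1 := by rw [abs_of_pos h0]; exact h1
  have hs : HasDerivAt (fun z : ℝ => 1 - z) (-1) s := by
    simpa using (hasDerivAt_id s).const_sub 1
  have hl := Real.hasDerivAt_log h0.ne'
  have e2 := fy_Li2_deriv ha h0.ne'
  have e3 := fy_Li_deriv 2 ha h0.ne'
  have e4 := fy_Li_deriv 3 ha h0.ne'
  have := ((((hs.log (by linarith)).neg.mul (hl.pow 3)).sub ((e2.const_mul 3).mul (hl.pow 2))).add
    ((e3.const_mul 6).mul hl)).sub (e4.const_mul 6)
  convert! this using 1
  have : 1 - s ≠ 0 := by linarith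
  simp
  field_simp
  ring

lemma fyM_deriv {s : ℝ} (h0 : 0 < s) (h1 : s < 1) :
    HasDerivAt fyM (Real.log s ^ 3 / (1 + s)) s := by
  have ha : |-s| < 1 := by rw [abs_neg, abs_of_pos h0]; exact h1
  have hs : HasDerivAt (fun z : ℝ => 1 + z) 1 s := by
    simpa using (hasDerivAt_id s).const_add 1
  have hn : HasDerivAt (fun z : ℝ => -z) (-1) s := hasDerivAt_neg s
  have hl := Real.hasDerivAt_log h0.ne'
  have e2 := (fy_Li2_deriv ha (by linarith)).comp s hn
  have e3 := (fy_Li_deriv 2 ha (by linarith)).comp s hn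
  have e4 := (fy_Li_deriv 3 ha (by linarith)).comp s hn
  have := ((((hs.log (by linarith)).mul (hl.pow 3)).add ((e2.const_mul 3).mul (hl.pow 2))).sub
    ((e3.const_mul 6).mul hl)).add (e4.const_mul 6)
  convert! this using 1
  have : 1 + s ≠ 0 := by linarith
  simp
  field_simp
  ring

noncomputable def fyΦ (t : ℝ) : ℝ :=
  -fyM (t / (1 - t)) + Real.log (1 - t) ^ 4 / 4 + 3 / 2 * Real.log t ^ 2 * Real.log (1 - t) ^ 2
    - Real.log t * Real.log (1 - t) ^ 3 + fyN t - fyN (1 - t)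

lemma fyΦ_deriv {t : ℝ} (h0 : 0 < t) (h1 : t < 1 / 2) :
    HasDerivAt fyΦ (3 * (Real.log t * (Real.log (1 - t) ^ 2 / t))) t := by
  have hne : 1 - t ≠ 0 := by linarith
  have hs : HasDerivAt (fun z : ℝ => 1 - z) (-1) t := by
    simpa using (hasDerivAt_id t).const_sub 1
  have hq : HasDerivAt (fun z : ℝ => z / (1 - z)) ((1 * (1 - t) - t * (-1)) / (1 - t) ^ 2) t :=
    (hasDerivAt_id t).div hs hne
  have hw1 : t / (1 - t) < 1 := by rw [div_lt_one (by linarith)]; linarith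
  have hw0 : 0 < t / (1 - t) := div_pos h0 (by linarith)
  have eM := (fyM_deriv hw0 hw1).comp t hq
  have eN := fyN_deriv h0 (by linarith)
  have eN' := (fyN_deriv (s := 1 - t) (by linarith) (by linarith)).comp t hs
  have hl := Real.hasDerivAt_log h0.ne'
  have hb := hs.log hne
  have := ((((eM.neg.add ((hb.pow 4).div_const 4)).add (((hl.pow 2).const_mul (3/2)).mul (hb.pow 2))).sub
    (hl.mul (hb.pow 3))).add eN).sub eN'
  convert! this using 1
  have h3 : 1 + t / (1 - t) = 1 / (1 - t) := by field_simp; ring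
  rw [h3, Real.log_div h0.ne' hne, show 1 - (1 - t) = t by ring]
  simp
  field_simp
  ring


lemma fy_Li_mul_bound (k : ℕ) (c s : ℝ) (hs : |s| ≤ 1) :
    ∀ᶠ t in 𝓝[>] (0:ℝ), |c * Li k (s * t)| ≤ |c| * 2 * t := by
  filter_upwards [fy_ev (1/2) (by norm_num)] with t ht
  have h1 : |s * t| ≤ t := by
    rw [abs_mul, abs_of_pos ht.1]; nlinarith [ht.1]
  have := fy_Li_bound k (h1.trans ht.2.le)
  rw [abs_mul]
  nlinarith [abs_nonneg c]

lemma fyN_zero : Tendsto fyN (𝓝[>] 0) (𝓝 0) := by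
  have e1 := fy_tl 3 _ 2 (fy_log_pow_bound 0)
  have e2 := fy_tl 2 _ _ (fy_Li_mul_bound 2 3 1 (by norm_num))
  have e3 := fy_tl 1 _ _ (fy_Li_mul_bound 3 6 1 (by norm_num))
  have e4 := fy_tl 0 _ _ (fy_Li_mul_bound 4 6 1 (by norm_num))
  have := ((e1.neg.sub e2).add e3).sub e4
  simp only [neg_zero, sub_zero, add_zero] at this
  refine this.congr ?_
  intro t
  simp only [fyN, one_mul, zero_add, pow_one, pow_zero]
  ring

lemma fyM_zero : Tendsto fyM (𝓝[>] 0) (𝓝 0) := by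
  have h1 : ∀ᶠ t in 𝓝[>] (0:ℝ), |Real.log (1 + t)| ≤ 1 * t := by
    filter_upwards [fy_ev 1 (by norm_num)] with t ht
    rw [abs_of_nonneg (Real.log_nonneg (by linarith [ht.1]))]
    linarith [Real.log_le_sub_one_of_pos (show 0 < 1 + t by linarith [ht.1])]
  have e1 := fy_tl 3 _ _ h1
  have e2 := fy_tl 2 _ _ (fy_Li_mul_bound 2 3 (-1) (by norm_num))
  have e3 := fy_tl 1 _ _ (fy_Li_mul_bound 3 6 (-1) (by norm_num))
  have e4 := fy_tl 0 _ _ (fy_Li_mul_bound 4 6 (-1) (by norm_num))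
  have := ((e1.add e2).sub e3).add e4
  simp only [sub_zero, add_zero] at this
  refine this.congr ?_
  intro t
  simp only [fyM, neg_one_mul, zero_add, pow_one, pow_zero]
  ring

lemma fy_log1_tendsto : Tendsto (fun t : ℝ => Real.log (1 - t)) (𝓝[>] 0) (𝓝 0) := by
  have := fy_tl 0 _ _ (fy_log_pow_bound 0)
  simpa using this

lemma fyN_one : Tendsto (fun t => fyN (1 - t)) (𝓝[>] 0) (𝓝 (-6 * zeta' 4)) := by
  have e1 := fy_tl 1 _ _ (fy_log_pow_bound 2)
  have hl := fy_log1_tendsto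
  have e2 := ((fy_Li_one_tendsto 2 le_rfl).const_mul 3).mul (hl.pow 2)
  have e3 := ((fy_Li_one_tendsto 3 (by norm_num)).const_mul 6).mul hl
  have e4 := ((fy_Li_one_tendsto 4 (by norm_num)).const_mul 6)
  have := ((e1.neg.sub e2).add e3).sub e4
  refine (this.congr ?_).trans_eq ?_
  · intro t
    simp only [fyN]
    rw [show 1 - (1 - t) = t by ring]
    ring
  · congr 1; ring

lemma fyΦ_zero : Tendsto fyΦ (𝓝[>] 0) (𝓝 (6 * zeta' 4)) := by
  have hw : Tendsto (fun t : ℝ => t / (1 - t)) (𝓝[>] 0) (𝓝[>] 0) := by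
    rw [tendsto_nhdsWithin_iff]
    constructor
    · have : ContinuousAt (fun t : ℝ => t / (1 - t)) 0 := by
        apply ContinuousAt.div <;> first | fun_prop | norm_num
      have h := this.tendsto
      simp only [zero_div] at h
      exact h.mono_left nhdsWithin_le_nhds
    · filter_upwards [fy_ev 1 (by norm_num)] with t ht
      exact div_pos ht.1 (by linarith [ht.2])
  have hl := fy_log1_tendsto
  have e1 := fy_tl 2 _ _ (fy_log_pow_bound 1)
  have e2 := fy_tl 1 _ _ (fy_log_pow_bound 2)
  have := ((((fyM_zero.comp hw).neg.add ((hl.pow 4).div_const 4)).add (e1.const_mul (3/2))).sub e2).add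
    fyN_zero |>.sub fyN_one
  refine (this.congr ?_).trans_eq ?_
  · intro t
    simp only [fyΦ, Function.comp]
    ring
  · congr 1; ring

lemma fyM_cont : ContinuousOn fyM (Ioc 0 1) := by
  have hl : ContinuousOn Real.log (Ioc (0:ℝ) 1) :=
    Real.continuousOn_log.mono (fun x hx => by simpa using hx.1.ne')
  have hl1 : ContinuousOn (fun x : ℝ => Real.log (1 + x)) (Ioc (0:ℝ) 1) :=
    ContinuousOn.log (by fun_prop) (fun x hx => by linarith [hx.1])
  have hL : ∀ k, 2 ≤ k → ContinuousOn (fun x => Li k (-x)) (Ioc (0:ℝ) 1) := fun k hk =>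
    (fy_Li_cont k hk).comp (by fun_prop) (fun x hx => by
      constructor <;> linarith [hx.1, hx.2])
  unfold fyM
  have h2 := hL 2 le_rfl
  have h3 := hL 3 (by norm_num)
  have h4 := hL 4 (by norm_num)
  fun_prop

lemma fyΦ_half : Tendsto fyΦ (𝓝[<] (1/2)) (𝓝 (fyΦ (1/2))) := by
  have hw : ContinuousOn (fun t : ℝ => t / (1 - t)) (Ioc 0 (1/2)) :=
    ContinuousOn.div (by fun_prop) (by fun_prop) (fun x hx => by linarith [hx.2])
  have hM : ContinuousOn (fun t : ℝ => fyM (t / (1 - t))) (Ioc 0 (1/2)) :=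
    fyM_cont.comp hw (fun x hx => by
      have : 0 < 1 - x := by linarith [hx.2]
      exact ⟨div_pos hx.1 this, by rw [div_le_one this]; linarith [hx.2]⟩)
  have hl : ContinuousOn Real.log (Ioc (0:ℝ) (1/2)) :=
    Real.continuousOn_log.mono (fun x hx => by simpa using hx.1.ne')
  have hl1 : ContinuousOn (fun x : ℝ => Real.log (1 - x)) (Ioc (0:ℝ) (1/2)) :=
    ContinuousOn.log (by fun_prop) (fun x hx => by linarith [hx.2])
  have hN : ContinuousOn fyN (Ioc (0:ℝ) (1/2)) := fun x hx =>
    (fyN_deriv hx.1 (by linarith [hx.2])).continuousAt.continuousWithinAt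
  have hN' : ContinuousOn (fun x => fyN (1 - x)) (Ioc (0:ℝ) (1/2)) := fun x hx =>
    ContinuousAt.continuousWithinAt (ContinuousAt.comp (f := fun x : ℝ => 1 - x)
      (fyN_deriv (by linarith [hx.2]) (by linarith [hx.1])).continuousAt (by fun_prop))
  have : ContinuousOn fyΦ (Ioc 0 (1/2)) := by
    unfold fyΦ
    fun_prop
  have h := (this (1/2) (by norm_num)).tendsto
  refine h.mono_left ?_
  refine nhdsWithin_le_of_mem ?_
  filter_upwards [Ioo_mem_nhdsLT (show (0:ℝ) < 1/2 by norm_num)] with t ht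
  exact ⟨ht.1, ht.2.le⟩

lemma fyΦ_half_val : fyΦ (1/2) = 21 / 4 * zeta' 4 + 3 / 4 * Real.log 2 ^ 4 := by
  have h : Real.log (1/2) = -Real.log 2 := by rw [one_div, Real.log_inv]
  have h1 : (1:ℝ) - 1/2 = 1/2 := by norm_num
  have h2 : fyM 1 = 6 * Li 4 (-1) := by
    simp [fyM]
  unfold fyΦ
  rw [h1, show (1:ℝ)/2/(1/2) = 1 by norm_num, h2, h, fy_Li4_neg_one]
  ring

lemma fy_int_bdd {ψ : ℝ → ℝ} {C b : ℝ} (hb : 0 ≤ b) (hm : Measurable ψ)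
    (hC : ∀ t ∈ Ioc 0 b, |ψ t| ≤ C) : IntervalIntegrable ψ volume 0 b := by
  refine (intervalIntegrable_const (c := C)).mono_fun hm.aestronglyMeasurable ?_
  rw [uIoc_of_le hb]
  filter_upwards [ae_restrict_mem measurableSet_Ioc] with t ht
  exact (hC t ht).trans (le_abs_self C)

lemma fy_int_log {ψ : ℝ → ℝ} {C b : ℝ} (hb : 0 ≤ b) (hm : Measurable ψ)
    (hC : ∀ t ∈ Ioc 0 b, |ψ t| ≤ C) :
    IntervalIntegrable (fun t => Real.log t * ψ t) volume 0 b := by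
  have h0 : IntervalIntegrable (fun t => C * Real.log t) volume 0 b :=
    intervalIntegral.intervalIntegrable_log'.const_mul C
  refine h0.mono_fun (Real.measurable_log.mul hm).aestronglyMeasurable ?_
  rw [uIoc_of_le hb]
  filter_upwards [ae_restrict_mem measurableSet_Ioc] with t ht
  rw [norm_mul, norm_mul, mul_comm]
  gcongr
  exact (hC t ht).trans (le_abs_self C)

noncomputable def fyψ (k : ℕ) (t : ℝ) : ℝ := Real.log (1 - t) ^ (k + 1) / t

lemma fyψ_meas (k : ℕ) : Measurable (fyψ k) := by
  unfold fyψ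
  fun_prop

lemma fyψ_bound (k : ℕ) : ∀ t ∈ Ioc (0:ℝ) (1/2), |fyψ k t| ≤ 2 := by
  intro t ht
  have h := fy_log_bound ht.1.le ht.2
  unfold fyψ
  rw [abs_div, abs_pow, abs_of_pos ht.1, div_le_iff₀ ht.1, pow_succ]
  have : |Real.log (1 - t)| ^ k ≤ 1 := pow_le_one₀ (abs_nonneg _) (by linarith [ht.2])
  calc _ ≤ 1 * |Real.log (1 - t)| := by gcongr
    _ ≤ _ := by linarith

lemma fyJ : ∫ t in (0:ℝ)..(1/2), Real.log t * fyψ 1 t = Real.log 2 ^ 4 / 4 - zeta' 4 / 4 := by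
  have hint := fy_int_log (by norm_num) (fyψ_meas 1) (fyψ_bound 1)
  have h := intervalIntegral.integral_eq_sub_of_hasDerivAt_of_tendsto (a := 0) (b := 1/2)
    (f := fyΦ) (f' := fun t => 3 * (Real.log t * fyψ 1 t)) (by norm_num)
    (fun t ht => fyΦ_deriv ht.1 ht.2) (hint.const_mul 3) fyΦ_zero fyΦ_half
  rw [intervalIntegral.integral_const_mul, fyΦ_half_val] at h
  linarith


noncomputable def fyL (x : ℝ) : ℝ := Real.log (max x 1)
noncomputable def fyr (x : ℝ) : ℝ := fyL (x - 1) / max x 1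
noncomputable def fyp2 (x : ℝ) : ℝ := ∫ t in (0:ℝ)..x, fyr t
noncomputable def fyr3 (x : ℝ) : ℝ := fyp2 (x - 1) / max x 1
noncomputable def fyp3 (x : ℝ) : ℝ := ∫ t in (0:ℝ)..x, fyr3 t
noncomputable def fyr4 (x : ℝ) : ℝ := fyp3 (x - 1) / max x 1
noncomputable def fyp4 (x : ℝ) : ℝ := ∫ t in (0:ℝ)..x, fyr4 t

lemma fy_max_pos (x : ℝ) : 0 < max x 1 := lt_max_of_lt_right one_pos

lemma fyL_cont : Continuous fyL := by
  unfold fyL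
  exact Continuous.log (by fun_prop) (fun x => (fy_max_pos x).ne')

lemma fyL_zero {x : ℝ} (h : x ≤ 1) : fyL x = 0 := by
  unfold fyL; rw [max_eq_right h, Real.log_one]

lemma fyL_eq {x : ℝ} (h : 1 ≤ x) : fyL x = Real.log x := by
  unfold fyL; rw [max_eq_left h]

lemma fyr_cont : Continuous fyr := by
  unfold fyr
  exact (fyL_cont.comp (by fun_prop)).div (by fun_prop) (fun x => (fy_max_pos x).ne')

lemma fyr_zero {x : ℝ} (h : x ≤ 2) : fyr x = 0 := by
  unfold fyr; rw [fyL_zero (by linarith), zero_div]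

lemma fyr_eq {x : ℝ} (h : 2 ≤ x) : fyr x = Real.log (x - 1) / x := by
  unfold fyr; rw [fyL_eq (by linarith), max_eq_left (by linarith)]

lemma fy_mul_r (x : ℝ) : x * fyr x = fyL (x - 1) := by
  rcases le_total x 2 with h | h
  · rw [fyr_zero h, fyL_zero (by linarith), mul_zero]
  · rw [fyr_eq h, fyL_eq (by linarith)]
    have : x ≠ 0 := by linarith
    field_simp

lemma fy_prim {r : ℝ → ℝ} (hr : Continuous r) (x : ℝ) :
    HasDerivAt (fun x => ∫ t in (0:ℝ)..x, r t) (r x) x :=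
  intervalIntegral.integral_hasDerivAt_right (hr.intervalIntegrable _ _)
    (hr.stronglyMeasurableAtFilter _ _) hr.continuousAt

lemma fy_prim_zero {r : ℝ → ℝ} {c : ℝ} (hc : 0 ≤ c) (hr : ∀ x ≤ c, r x = 0) {x : ℝ} (hx : x ≤ c) :
    ∫ t in (0:ℝ)..x, r t = 0 := by
  rw [intervalIntegral.integral_congr (g := fun _ => 0)]
  · simp
  · intro t ht
    exact hr t (ht.2.trans (max_le hc hx))

lemma fyp2_deriv (x : ℝ) : HasDerivAt fyp2 (fyr x) x := fy_prim fyr_cont x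
lemma fyp2_cont : Continuous fyp2 :=
  continuous_iff_continuousAt.2 fun x => (fyp2_deriv x).continuousAt
lemma fyp2_zero {x : ℝ} (h : x ≤ 2) : fyp2 x = 0 :=
  fy_prim_zero (by norm_num) (fun _ hx => fyr_zero hx) h
lemma fyr3_cont : Continuous fyr3 := by
  unfold fyr3
  exact (fyp2_cont.comp (by fun_prop)).div (by fun_prop) (fun x => (fy_max_pos x).ne')
lemma fyr3_zero {x : ℝ} (h : x ≤ 3) : fyr3 x = 0 := by
  unfold fyr3; rw [fyp2_zero (by linarith), zero_div]
lemma fyp3_deriv (x : ℝ) : HasDerivAt fyp3 (fyr3 x) x := fy_prim fyr3_cont x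
lemma fyp3_cont : Continuous fyp3 :=
  continuous_iff_continuousAt.2 fun x => (fyp3_deriv x).continuousAt
lemma fyp3_zero {x : ℝ} (h : x ≤ 3) : fyp3 x = 0 :=
  fy_prim_zero (by norm_num) (fun _ hx => fyr3_zero hx) h
lemma fyr4_cont : Continuous fyr4 := by
  unfold fyr4
  exact (fyp3_cont.comp (by fun_prop)).div (by fun_prop) (fun x => (fy_max_pos x).ne')
lemma fyr4_zero {x : ℝ} (h : x ≤ 4) : fyr4 x = 0 := by
  unfold fyr4; rw [fyp3_zero (by linarith), zero_div]
lemma fyp4_deriv (x : ℝ) : HasDerivAt fyp4 (fyr4 x) x := fy_prim fyr4_cont x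
lemma fyp4_cont : Continuous fyp4 :=
  continuous_iff_continuousAt.2 fun x => (fyp4_deriv x).continuousAt
lemma fyp4_zero {x : ℝ} (h : x ≤ 4) : fyp4 x = 0 :=
  fy_prim_zero (by norm_num) (fun _ hx => fyr4_zero hx) h

/-- explicit form of P_2 -/
lemma fyp2_eq {u : ℝ} (hu : 2 ≤ u) :
    fyp2 u = 1 / 2 * Real.log u ^ 2 + Li 2 (1 / u) - zeta' 2 / 2 := by
  set q : ℝ → ℝ := fun u => 1 / 2 * Real.log u ^ 2 + Li 2 (1 / u) - zeta' 2 / 2 with hq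
  have hd : ∀ x, 2 ≤ x → HasDerivAt (fun x => fyp2 x - q x) 0 x := by
    intro x hx
    have hx0 : x ≠ 0 := by linarith
    have hi : HasDerivAt (fun x : ℝ => 1 / x) (-1 / x ^ 2) x := by
      have := hasDerivAt_inv hx0
      simp only [one_div]
      convert! this using 1
      ring
    have hx1 : |1 / x| < 1 := by
      rw [abs_of_pos (by positivity), div_lt_one (by linarith)]; linarith
    have e := (((((Real.hasDerivAt_log hx0).pow 2).const_mul (1/2)).add
      ((fy_Li2_deriv hx1 (by positivity)).comp x hi)).sub_const (zeta' 2 / 2))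
    have := (fyp2_deriv x).sub e
    convert! this using 1
    have h1 : 1 - 1 / x = (x - 1) / x := by field_simp
    rw [fyr_eq hx, h1, Real.log_div (by linarith) hx0]
    simp
    field_simp
    ring
  have := fy_const hu (fun x hx => (hd x hx.1).continuousAt.continuousWithinAt)
    (fun x hx => hd x hx.1.le)
  have h2 : q 2 = 0 := by
    have := fy_Li_refl (x := 1/2) (by norm_num) (by norm_num)
    rw [show (1:ℝ) - 1/2 = 1/2 by norm_num, one_div, Real.log_inv] at this
    simp only [hq, one_div]
    linarith
  rw [h2, fyp2_zero le_rfl] at this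
  change fyp2 u = q u
  linarith

lemma fy_param {f g g' : ℝ → ℝ} (hf : Continuous f) (hg' : Continuous g')
    (hg : ∀ x, HasDerivAt g (g' x) x) (a b u : ℝ) :
    HasDerivAt (fun u => ∫ x in a..b, f x * g (u - x)) (∫ x in a..b, f x * g' (u - x)) u := by
  have hgc : Continuous g := continuous_iff_continuousAt.2 fun x => (hg x).continuousAt
  have hK : IsCompact (Metric.closedBall u 1 ×ˢ uIcc a b) :=
    (isCompact_closedBall u 1).prod isCompact_uIcc
  obtain ⟨C, hC⟩ := hK.exists_bound_of_continuousOn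
    (f := fun p : ℝ × ℝ => f p.2 * g' (p.1 - p.2)) (by fun_prop)
  refine (intervalIntegral.hasDerivAt_integral_of_dominated_loc_of_deriv_le
    (F := fun u x => f x * g (u - x)) (F' := fun u x => f x * g' (u - x)) (bound := fun _ => C)
    (s := Metric.closedBall u 1) (Metric.closedBall_mem_nhds u one_pos) ?_ ?_ ?_ ?_ ?_ ?_).2
  · exact Eventually.of_forall fun v => Continuous.aestronglyMeasurable (by fun_prop)
  · exact Continuous.intervalIntegrable (by fun_prop) _ _
  · exact Continuous.aestronglyMeasurable (by fun_prop)
  · refine Eventually.of_forall fun x hx v hv => ?_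
    exact hC (v, x) ⟨hv, uIoc_subset_uIcc hx⟩
  · exact intervalIntegrable_const
  · refine Eventually.of_forall fun x hx v hv => ?_
    have : HasDerivAt (fun v => g (v - x)) (g' (v - x)) v := by
      simpa using (hg (v - x)).comp_sub_const v x
    exact this.const_mul (f x)

lemma fy_trunc {f : ℝ → ℝ} (hf : Continuous f) {a c b : ℝ}
    (h0 : ∀ x ∈ Icc c b, f x = 0) (hcb : c ≤ b) : ∫ x in a..b, f x = ∫ x in a..c, f x := by
  rw [← intervalIntegral.integral_add_adjacent_intervals (hf.intervalIntegrable a c)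
    (hf.intervalIntegrable c b), intervalIntegral.integral_congr (a := c) (b := b) (g := fun _ => 0)]
  · simp
  · intro x hx
    rw [uIcc_of_le hcb] at hx
    exact h0 x hx

noncomputable def fyi (x : ℝ) : ℝ := 1 / max x 1
lemma fyi_cont : Continuous fyi := by
  unfold fyi
  exact continuous_const.div (by fun_prop) (fun x => (fy_max_pos x).ne')
lemma fyi_eq {x : ℝ} (h : 1 ≤ x) : fyi x = 1 / x := by unfold fyi; rw [max_eq_left h]

lemma fy_convB {w A : ℝ} (h1 : 1 ≤ A) (hA : w ≤ A) :
    ∫ x in (1:ℝ)..A, fyi x * fyL (w - x) = 2 * fyp2 w := by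
  have hc : Continuous (fun x => fyi x * fyL (w - x)) :=
    fyi_cont.mul (fyL_cont.comp (by fun_prop))
  rcases le_total w 2 with h | h
  · rw [fyp2_zero h, intervalIntegral.integral_congr (g := fun _ => 0)]
    · simp
    · intro x hx
      rw [uIcc_of_le h1] at hx
      simp only
      rw [fyL_zero (by linarith [hx.1]), mul_zero]
  · rw [fy_trunc hc (c := w - 1) (fun x hx => by rw [fyL_zero (by linarith [hx.1]), mul_zero])
      (by linarith)]
    have hw0 : 0 < w := by linarith
    have := intervalIntegral.integral_eq_sub_of_hasDerivAt (a := 1) (b := w - 1)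
      (f := fun x => Real.log w * Real.log x - Li 2 (x / w)) (f' := fun x => fyi x * fyL (w - x))
      ?_ (hc.intervalIntegrable _ _)
    · rw [this, fyp2_eq h]
      have hr := fy_Li_refl (x := 1 / w) (by positivity) (by rw [div_lt_one hw0]; linarith)
      have e : (w - 1) / w = 1 - 1 / w := by field_simp
      have e2 : Real.log (w - 1) = Real.log w + Real.log (1 - 1 / w) := by
        rw [← e, Real.log_div (by linarith) hw0.ne']; ring
      rw [one_div, Real.log_inv, ← one_div] at hr
      rw [e, e2, Real.log_one]
      linear_combination -hr
    · intro x hx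
      rw [uIcc_of_le (by linarith)] at hx
      have hx0 : 0 < x := by linarith [hx.1]
      have hxw : x < w := by linarith [hx.2]
      have h3 : |x / w| < 1 := by
        rw [abs_of_pos (by positivity), div_lt_one hw0]; exact hxw
      have hd : HasDerivAt (fun x : ℝ => x / w) (1 / w) x := (hasDerivAt_id x).div_const w
      have := ((Real.hasDerivAt_log hx0.ne').const_mul (Real.log w)).sub
        ((fy_Li2_deriv h3 (by positivity)).comp x hd)
      convert! this using 1
      rw [fyi_eq hx.1, fyL_eq (by linarith [hx.2]),
        show 1 - x / w = (w - x) / w by field_simp, Real.log_div (by linarith) hw0.ne']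
      field_simp
      ring

lemma fy_convA {v A : ℝ} (h1 : 1 ≤ v) (hA : v ≤ A) :
    ∫ x in (1:ℝ)..A, fyi x * fyp2 (v - x) = 3 * fyp3 v := by
  set a : ℝ → ℝ := fun v => ∫ x in (1:ℝ)..A, fyi x * fyp2 (v - x) with ha
  have hd : ∀ v, 1 ≤ v → v ≤ A → HasDerivAt (fun v => a v - 3 * fyp3 v) 0 v := by
    intro v hv hvA
    have e := (fy_param fyi_cont fyr_cont fyp2_deriv 1 A v).sub ((fyp3_deriv v).const_mul 3)
    convert! e using 1
    have hc1 : Continuous (fun x => fyr (v - x)) := fyr_cont.comp (by fun_prop)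
    have hc2 : Continuous (fun x => fyi x * fyL (v - 1 - x)) :=
      fyi_cont.mul (fyL_cont.comp (by fun_prop))
    have key : v * ∫ x in (1:ℝ)..A, fyi x * fyr (v - x) = 3 * fyp2 (v - 1) := by
      rw [← intervalIntegral.integral_const_mul, intervalIntegral.integral_congr
        (g := fun x => fyr (v - x) + fyi x * fyL (v - 1 - x)),
        intervalIntegral.integral_add (hc1.intervalIntegrable _ _) (hc2.intervalIntegrable _ _),
        fy_convB (by linarith) (by linarith), intervalIntegral.integral_comp_sub_left,
        intervalIntegral.integral_eq_sub_of_hasDerivAt (fun x _ => fyp2_deriv x)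
          (fyr_cont.intervalIntegrable _ _), fyp2_zero (show v - A ≤ 2 by linarith)]
      · ring
      · intro x hx
        rw [uIcc_of_le (by linarith)] at hx
        have hx0 : x ≠ 0 := by linarith [hx.1]
        simp only
        rw [show v - 1 - x = (v - x) - 1 by ring, ← fy_mul_r, fyi_eq hx.1]
        field_simp
        ring
    have hv0 : v ≠ 0 := by linarith
    unfold fyr3
    rw [max_eq_left hv]
    field_simp
    linarith
  have := fy_const h1 (fun x hx => (hd x hx.1 (hx.2.trans hA)).continuousAt.continuousWithinAt)
    (fun x hx => hd x hx.1.le (hx.2.le.trans hA))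
  have h0 : a 1 = 0 := by
    simp only [ha]
    rw [intervalIntegral.integral_congr (g := fun _ => 0)]
    · simp
    · intro x hx
      rw [uIcc_of_le (by linarith)] at hx
      simp only
      rw [fyp2_zero (by linarith [hx.1]), mul_zero]
  rw [h0, fyp3_zero (show (1:ℝ) ≤ 3 by norm_num)] at this
  change a v = _
  linarith

lemma fy_convK {u A : ℝ} (h1 : 2 ≤ A) (hA : u ≤ A) :
    ∫ x in (0:ℝ)..A, fyL (x - 1) * fyr (u - x) = 3 * fyp3 (u - 1) := by
  have hc : Continuous (fun x => fyL (x - 1) * fyr (u - x)) :=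
    (fyL_cont.comp (by fun_prop)).mul (fyr_cont.comp (by fun_prop))
  rcases lt_or_ge u 2 with hu | hu
  · rw [fyp3_zero (by linarith), intervalIntegral.integral_congr (g := fun _ => 0)]
    · simp
    · intro x hx
      rw [uIcc_of_le (by linarith)] at hx
      simp only
      rw [fyr_zero (by linarith [hx.1]), mul_zero]
  have hz : ∫ x in (0:ℝ)..2, fyL (x - 1) * fyr (u - x) = 0 := by
    rw [intervalIntegral.integral_congr (g := fun _ => 0)]
    · simp
    · intro x hx
      rw [uIcc_of_le (by norm_num)] at hx
      simp only
      rw [fyL_zero (by linarith [hx.2]), zero_mul]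
  rw [← intervalIntegral.integral_add_adjacent_intervals (hc.intervalIntegrable 0 2)
    (hc.intervalIntegrable 2 A), hz, zero_add]
  have hc1 : Continuous (fun x => fyr (u - x)) := fyr_cont.comp (by fun_prop)
  have hc2 : Continuous (fun x => fyi (x - 1)) := fyi_cont.comp (by fun_prop)
  have hbp := intervalIntegral.integral_mul_deriv_eq_deriv_mul (a := 2) (b := A)
    (u := fun x => Real.log (x - 1)) (u' := fun x => fyi (x - 1))
    (v := fun x => -fyp2 (u - x)) (v' := fun x => fyr (u - x)) ?_ ?_
    (hc2.intervalIntegrable _ _) (hc1.intervalIntegrable _ _)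
  · rw [intervalIntegral.integral_congr (g := fun x => Real.log (x - 1) * fyr (u - x)), hbp,
      fyp2_zero (show u - A ≤ 2 by linarith)]
    · have h3 : ∫ x in (2:ℝ)..A, fyi (x - 1) * -fyp2 (u - x)
          = -∫ x in (2:ℝ)..A, (fun y => fyi y * fyp2 (u - 1 - y)) (x - 1) := by
        rw [← intervalIntegral.integral_neg]
        refine intervalIntegral.integral_congr fun x _ => ?_
        simp only
        rw [show u - 1 - (x - 1) = u - x by ring]
        ring
      rw [h3, intervalIntegral.integral_comp_sub_right (fun y => fyi y * fyp2 (u - 1 - y)), show (2:ℝ) - 1 = 1 by norm_num,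
        fy_convA (by linarith) (by linarith)]
      simp
    · intro x hx
      rw [uIcc_of_le h1] at hx
      simp only
      rw [fyL_eq (by linarith [hx.1])]
  · intro x hx
    rw [uIcc_of_le h1] at hx
    rw [fyi_eq (by linarith [hx.1])]
    exact HasDerivAt.log (by simpa using (hasDerivAt_id x).sub_const 1) (by linarith [hx.1])
  · intro x hx
    have := ((fyp2_deriv (u - x)).comp_const_sub u x).neg
    convert! this using 1
    ring

lemma fy_convG' {u A : ℝ} (hu : 2 ≤ A) (hu1 : 1 ≤ u) (hA : u ≤ A) :
    ∫ x in (0:ℝ)..A, fyr x * fyp2 (u - x) = 6 * fyp4 u := by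
  set a : ℝ → ℝ := fun u => ∫ x in (0:ℝ)..A, fyr x * fyp2 (u - x) with ha
  have hd : ∀ v, 1 ≤ v → v ≤ A → HasDerivAt (fun v => a v - 6 * fyp4 v) 0 v := by
    intro v hv hvA
    have e := (fy_param fyr_cont fyr_cont fyp2_deriv 0 A v).sub ((fyp4_deriv v).const_mul 6)
    convert! e using 1
    have hc1 : Continuous (fun x => fyL (x - 1) * fyr (v - x)) :=
      (fyL_cont.comp (by fun_prop)).mul (fyr_cont.comp (by fun_prop))
    have hc2 : Continuous (fun x => fyr x * fyL (v - x - 1)) :=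
      fyr_cont.mul (fyL_cont.comp (by fun_prop))
    have hsym : ∫ x in (0:ℝ)..A, fyr x * fyL (v - x - 1) = 3 * fyp3 (v - 1) := by
      rw [← fy_convK hu hvA, fy_trunc hc1 (c := v) _ hvA, fy_trunc hc2 (c := v) _ hvA]
      · have := intervalIntegral.integral_comp_sub_left (a := 0) (b := v)
          (fun x => fyL (x - 1) * fyr (v - x)) v
        rw [sub_self, sub_zero] at this
        rw [← this]
        refine intervalIntegral.integral_congr fun x _ => ?_
        rw [sub_sub_cancel, mul_comm]
      · intro x hx
        rw [fyL_zero (by linarith [hx.1]), mul_zero]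
      · intro x hx
        rw [fyr_zero (by linarith [hx.1]), mul_zero]
    have key : v * ∫ x in (0:ℝ)..A, fyr x * fyr (v - x) = 6 * fyp3 (v - 1) := by
      rw [← intervalIntegral.integral_const_mul, intervalIntegral.integral_congr
        (g := fun x => fyL (x - 1) * fyr (v - x) + fyr x * fyL (v - x - 1)),
        intervalIntegral.integral_add (hc1.intervalIntegrable _ _) (hc2.intervalIntegrable _ _),
        hsym, fy_convK hu hvA]
      · ring
      · intro x hx
        simp only
        rw [← fy_mul_r, ← fy_mul_r]
        ring
    have hv0 : v ≠ 0 := by linarith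
    unfold fyr4
    rw [max_eq_left hv]
    field_simp
    linarith
  have := fy_const hu1
    (fun x hx => (hd x hx.1 (hx.2.trans hA)).continuousAt.continuousWithinAt)
    (fun x hx => hd x hx.1.le (hx.2.le.trans hA))
  have h0 : a 1 = 0 := by
    simp only [ha]
    rw [intervalIntegral.integral_congr (g := fun _ => 0)]
    · simp
    · intro x hx
      rw [uIcc_of_le (by linarith)] at hx
      simp only
      rw [fyp2_zero (by linarith [hx.1]), mul_zero]
  rw [h0, fyp4_zero (show (1:ℝ) ≤ 4 by norm_num)] at this
  change a u = _
  linarith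

lemma fy_half {u : ℝ} (hu : 2 ≤ u) :
    6 * fyp4 u = 2 * (∫ x in (0:ℝ)..(u/2), fyr x * fyp2 (u - x)) - fyp2 (u / 2) ^ 2 := by
  have hc : Continuous (fun x => fyr x * fyp2 (u - x)) :=
    fyr_cont.mul (fyp2_cont.comp (by fun_prop))
  have hc' : Continuous (fun x => fyr (u - x) * fyp2 x) :=
    (fyr_cont.comp (by fun_prop)).mul fyp2_cont
  rw [← fy_convG' hu (by linarith) le_rfl, ← intervalIntegral.integral_add_adjacent_intervals
    (hc.intervalIntegrable 0 (u/2)) (hc.intervalIntegrable (u/2) u)]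
  have h1 : ∫ x in (u/2)..u, fyr x * fyp2 (u - x) = ∫ x in (0:ℝ)..(u/2), fyr (u - x) * fyp2 x := by
    have := intervalIntegral.integral_comp_sub_left (a := u/2) (b := u)
      (fun x => fyr (u - x) * fyp2 x) u
    rw [sub_self, sub_half] at this
    rw [← this]
    refine intervalIntegral.integral_congr fun x _ => ?_
    rw [sub_sub_cancel]
  have h2 : ∫ x in (0:ℝ)..(u/2), (fyr (u - x) * fyp2 x - fyr x * fyp2 (u - x))
      = -fyp2 (u / 2) ^ 2 := by
    rw [intervalIntegral.integral_eq_sub_of_hasDerivAt (f := fun x => -(fyp2 (u - x) * fyp2 x))]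
    · rw [fyp2_zero (show (0:ℝ) ≤ 2 by norm_num), sub_half]; ring
    · intro x _
      have := (((fyp2_deriv (u - x)).comp_const_sub u x).mul (fyp2_deriv x)).neg
      convert! this using 1
      ring
    · exact (hc'.sub hc).intervalIntegrable _ _
  rw [intervalIntegral.integral_sub (hc'.intervalIntegrable _ _) (hc.intervalIntegrable _ _)] at h2
  rw [h1]
  linarith


noncomputable def fyh (x : ℝ) : ℝ :=
  (Real.log (x / (1 + 2 * x)) * Li 2 x - (1 / 2) * Real.log x ^ 2 * Real.log (1 + 2 * x))
    / (x * (1 + x))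

noncomputable def fyH (y : ℝ) : ℝ := ∫ x in (0:ℝ)..y, fyh x

lemma fyH4_eq {y : ℝ} (h0 : 0 ≤ y) (h1 : y ≤ 1 / 2) : H4 y = fyH y := by
  unfold H4 fyH
  refine intervalIntegral.integral_congr_ae ?_
  have : ∀ᵐ x : ℝ, x ≠ 1 / 2 := by
    rw [ae_iff]; simp
  filter_upwards [this] with x hx hx2
  rw [uIoc_of_le h0] at hx2
  have hlt : x < 1 / 2 := lt_of_le_of_ne (hx2.2.trans h1) hx
  have ha : |-2 * x| < 1 := by
    rw [abs_lt]; constructor <;> linarith [hx2.1]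
  unfold fyh
  rw [fy_Li1 ha]
  rw [show 1 - -2 * x = 1 + 2 * x by ring]
  ring

lemma fyh_cont {x : ℝ} (h0 : 0 < x) (h1 : x < 1) : ContinuousAt fyh x := by
  have hL : ContinuousAt (Li 2) x :=
    (fy_Li2_deriv (by rw [abs_of_pos h0]; exact h1) h0.ne').continuousAt
  have hl : ContinuousAt Real.log x := Real.continuousAt_log h0.ne'
  have h2 : ContinuousAt (fun x : ℝ => Real.log (1 + 2 * x)) x :=
    ContinuousAt.log (by fun_prop) (by linarith)
  have h3 : ContinuousAt (fun x : ℝ => Real.log (x / (1 + 2 * x))) x :=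
    ContinuousAt.log (ContinuousAt.div (by fun_prop) (by fun_prop) (by linarith))
      (by positivity)
  unfold fyh
  exact ContinuousAt.div (by fun_prop) (by fun_prop) (by positivity)

lemma fyh_bound {x : ℝ} (h0 : 0 < x) (h1 : x ≤ 1 / 2) : |fyh x| ≤ 26 * x ^ (-(1/2) : ℝ) := by
  have hL : |Li 2 x| ≤ 2 * x := by
    have := fy_Li_bound 2 (z := x) (by rw [abs_of_pos h0]; exact h1)
    rwa [abs_of_pos h0] at this
  have hl2 : 0 ≤ Real.log (1 + 2 * x) := Real.log_nonneg (by linarith)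
  have hl2' : Real.log (1 + 2 * x) ≤ 2 * x := by
    linarith [Real.log_le_sub_one_of_pos (show 0 < 1 + 2 * x by linarith)]
  have hq := Real.abs_log_mul_self_rpow_lt x (1/4) h0 (by linarith) (by norm_num)
  set s : ℝ := x ^ (-(1/4) : ℝ) with hs
  have hs0 : 0 < s := Real.rpow_pos_of_pos h0 _
  have hs2 : x ^ (-(1/2) : ℝ) = s ^ 2 := by
    rw [hs, ← Real.rpow_natCast, ← Real.rpow_mul h0.le]; norm_num
  have hs1 : 1 ≤ s := Real.one_le_rpow_of_pos_of_le_one_of_nonpos h0 (by linarith) (by norm_num)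
  have hinv : x ^ (1/4 : ℝ) * s = 1 := by
    rw [hs, ← Real.rpow_add h0]; norm_num
  have hlog : |Real.log x| ≤ 4 * s := by
    rw [abs_mul, abs_of_pos (Real.rpow_pos_of_pos h0 _)] at hq
    have : |Real.log x| = |Real.log x| * x ^ (1/4 : ℝ) * s := by
      rw [mul_assoc, hinv, mul_one]
    rw [this]
    have : (1:ℝ) / (1/4) = 4 := by norm_num
    rw [this] at hq
    gcongr
  unfold fyh
  rw [hs2, abs_div, abs_of_pos (show 0 < x * (1 + x) by positivity), div_le_iff₀ (by positivity),
    Real.log_div h0.ne' (by linarith)]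
  have h5 : |(Real.log x - Real.log (1 + 2 * x)) * Li 2 x| ≤ (4 * s + 1) * (2 * x) := by
    rw [abs_mul]
    gcongr
    calc _ ≤ |Real.log x| + |Real.log (1 + 2 * x)| := abs_sub _ _
      _ ≤ _ := by rw [abs_of_nonneg hl2]; linarith
  have h6 : |1 / 2 * Real.log x ^ 2 * Real.log (1 + 2 * x)| ≤ 1 / 2 * (4 * s) ^ 2 * (2 * x) := by
    rw [abs_mul, abs_mul, abs_pow, abs_of_nonneg hl2, abs_of_pos (by norm_num : (0:ℝ) < 1/2)]
    gcongr
  calc _ ≤ _ + _ := abs_sub _ _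
    _ ≤ (4 * s + 1) * (2 * x) + 1 / 2 * (4 * s) ^ 2 * (2 * x) := add_le_add h5 h6
    _ ≤ 26 * s ^ 2 * x := by nlinarith [mul_pos h0 hs0, mul_nonneg h0.le (by nlinarith : 0 ≤ s ^ 2 - s), mul_nonneg h0.le (by nlinarith : 0 ≤ s ^ 2 - 1)]
    _ ≤ _ := by
      have : 0 ≤ s ^ 2 * x ^ 2 := by positivity
      nlinarith

lemma fyh_int_half : IntervalIntegrable fyh volume 0 (1/2) := by
  have h0 : IntervalIntegrable (fun x : ℝ => 26 * x ^ (-(1/2) : ℝ)) volume 0 (1/2) :=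
    (intervalIntegral.intervalIntegrable_rpow' (by norm_num)).const_mul 26
  refine h0.mono_fun ?_ ?_
  · rw [uIoc_of_le (by norm_num)]
    refine ContinuousOn.aestronglyMeasurable ?_ measurableSet_Ioc
    intro x hx
    exact (fyh_cont hx.1 (by linarith [hx.2])).continuousWithinAt
  · rw [uIoc_of_le (by norm_num)]
    filter_upwards [ae_restrict_mem measurableSet_Ioc] with t ht
    exact (fyh_bound ht.1 ht.2).trans (le_abs_self _)

lemma fyh_int {y : ℝ} (h0 : 0 < y) (h1 : y < 1) : IntervalIntegrable fyh volume 0 y := by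
  refine fyh_int_half.trans ?_
  refine ContinuousOn.intervalIntegrable ?_
  intro x hx
  have hx1 : min (1/2) y ≤ x := hx.1
  have hx2 : x ≤ max (1/2) y := hx.2
  refine (fyh_cont (lt_of_lt_of_le (lt_min (by norm_num) h0) hx1)
    (lt_of_le_of_lt hx2 (max_lt (by norm_num) h1))).continuousWithinAt

lemma fyH_deriv {y : ℝ} (h0 : 0 < y) (h1 : y < 1) : HasDerivAt fyH (fyh y) y := by
  refine intervalIntegral.integral_hasDerivAt_right (fyh_int h0 h1) ?_ (fyh_cont h0 h1)
  refine ContinuousOn.stronglyMeasurableAtFilter (s := Ioo 0 1) isOpen_Ioo ?_ y ⟨h0, h1⟩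
  intro x hx
  exact (fyh_cont hx.1 hx.2).continuousWithinAt

lemma fyH_zero : Tendsto fyH (𝓝[>] 0) (𝓝 0) := by
  have h : ContinuousOn fyH (uIcc 0 (1/2)) :=
    intervalIntegral.continuousOn_primitive_interval' fyh_int_half (by simp)
  have h2 := (h 0 (by simp)).tendsto
  have h3 : fyH 0 = 0 := by unfold fyH; simp
  rw [h3, uIcc_of_le (by norm_num)] at h2
  refine h2.mono_left (nhdsWithin_le_of_mem ?_)
  filter_upwards [fy_ev (1/2) (by norm_num)] with t ht
  exact ⟨ht.1.le, ht.2.le⟩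

lemma fyE4_deriv {y : ℝ} (h0 : 0 < y) (h1 : y < 1) :
    HasDerivAt E4 (1 / 2 * Real.log y ^ 3 / (y * (1 + y))) y := by
  have ha : |-y| < 1 := by rw [abs_neg, abs_of_pos h0]; exact h1
  have hn : HasDerivAt (fun z : ℝ => -z) (-1) y := hasDerivAt_neg y
  have hl := Real.hasDerivAt_log h0.ne'
  have e1 := (fy_Li_deriv 0 ha (by linarith)).comp y hn
  have e2 := (fy_Li_deriv 1 ha (by linarith)).comp y hn
  have e3 := (fy_Li_deriv 2 ha (by linarith)).comp y hn
  have e4 := (fy_Li_deriv 3 ha (by linarith)).comp y hn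
  have := ((((((hasDerivAt_const y ((19:ℝ)/16 * zeta' 4)).sub (e4.const_mul 3)).add ((e3.const_mul 3).mul hl)).sub
    ((e2.const_mul (3/2)).mul (hl.pow 2))).add ((e1.const_mul (1/2)).mul (hl.pow 3))).add
    ((hl.pow 4).const_mul (1/8)))
  convert! this using 1
  rw [fy_Li0 ha]
  have : 1 + y ≠ 0 := by linarith
  have h' : 1 - -y ≠ 0 := by linarith
  simp
  field_simp
  ring

noncomputable def fyF (u : ℝ) : ℝ :=
  fyp4 u - (fyp3 (u - 1) * Real.log u
        + (zeta' 2 / 4) * (2 * Li 2 (1 - 1 / u) + (Real.log u) ^ 2)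
        - E4 (1 / (u - 2)) - fyH (1 / (u - 2)))

lemma fyF_deriv {u : ℝ} (hu : 4 ≤ u) : HasDerivAt fyF 0 u := by
  have hu0 : u ≠ 0 := by linarith
  have hu1 : u - 1 ≠ 0 := by linarith
  have hu2 : u - 2 ≠ 0 := by linarith
  have hp : 0 < u - 2 := by linarith
  have hy : HasDerivAt (fun u : ℝ => 1 / (u - 2)) (-1 / (u - 2) ^ 2) u := by
    have := ((hasDerivAt_id u).sub_const 2).inv hu2
    simp only [one_div]
    convert! this using 1
  have hi : HasDerivAt (fun u : ℝ => 1 - 1 / u) (1 / u ^ 2) u := by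
    have := (hasDerivAt_inv hu0).const_sub 1
    simp only [one_div]
    convert! this using 1
    simp
  have hi1 : |1 - 1 / u| < 1 := by
    have h1 : 0 < 1 / u := by positivity
    have h2 : 1 / u < 1 := by rw [div_lt_one (by linarith)]; linarith
    rw [abs_lt]; constructor <;> linarith
  have hi0 : 1 - 1 / u = (u - 1) / u := by field_simp
  have hy0 : 0 < 1 / (u - 2) := by positivity
  have hy1 : 1 / (u - 2) < 1 := by rw [div_lt_one hp]; linarith
  have hl := Real.hasDerivAt_log hu0
  have e1 := ((fyp3_deriv (u - 1)).comp_sub_const u 1).mul hl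
  have e2 := ((((fy_Li2_deriv hi1 (by rw [hi0]; exact div_ne_zero hu1 hu0)).comp u hi).const_mul 2).add
    (hl.pow 2)).const_mul (zeta' 2 / 4)
  have e3 := (fyE4_deriv hy0 hy1).comp u hy
  have e4 := (fyH_deriv hy0 hy1).comp u hy
  have := (fyp4_deriv u).sub (((e1.add e2).sub e3).sub e4)
  convert! this using 1
  unfold fyr4 fyr3 fyh
  have hu2' : 2 ≤ u - 1 - 1 := by linarith
  rw [fyp2_eq hu2', max_eq_left (show 1 ≤ u by linarith), max_eq_left (show 1 ≤ u - 1 by linarith),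
    show u - 1 - 1 = u - 2 by ring, show 1 - (1 - 1 / u) = 1 / u by ring]
  have a1 : 1 + 2 * (1 / (u - 2)) = u / (u - 2) := by field_simp; ring
  have a2 : 1 + 1 / (u - 2) = (u - 1) / (u - 2) := by field_simp; ring
  have a3 : 1 / (u - 2) / (u / (u - 2)) = 1 / u := by field_simp
  rw [a1, a2, a3, hi0, Real.log_div hu0 hu2]
  simp only [one_div, Real.log_inv]
  simp
  field_simp
  ring


def fyS (f : ℝ → ℝ) : Prop := ∀ n : ℕ, Tendsto (fun u => Real.log u ^ n * f u) atTop (𝓝 0)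

lemma fyS_of {f : ℝ → ℝ} {C : ℝ} (h : ∀ᶠ u in atTop, |f u| ≤ C * (√u)⁻¹) : fyS f := by
  intro n
  have h1 := (isLittleO_log_rpow_rpow_atTop (n : ℝ) (show (0:ℝ) < 1/2 by norm_num)).tendsto_div_nhds_zero
  have h2 := h1.const_mul C
  rw [mul_zero] at h2
  refine squeeze_zero_norm' ?_ h2
  filter_upwards [h, eventually_ge_atTop 1] with u hu h1
  have hl : 0 ≤ Real.log u := Real.log_nonneg h1
  rw [norm_mul, norm_pow, Real.norm_eq_abs, Real.norm_eq_abs, abs_of_nonneg hl, Real.rpow_natCast,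
    ← Real.sqrt_eq_rpow, div_eq_mul_inv]
  have := mul_le_mul_of_nonneg_left hu (pow_nonneg hl n)
  linarith

lemma fyS.t0 {f : ℝ → ℝ} (h : fyS f) : Tendsto f atTop (𝓝 0) := by simpa using h 0

lemma fyS.tm {f g : ℝ → ℝ} (h : fyS f) (hg : Tendsto g atTop (𝓝 0)) (n : ℕ) :
    Tendsto (fun u => Real.log u ^ n * f u * g u) atTop (𝓝 0) := by
  simpa using (h n).mul hg

lemma fyS.add {f g : ℝ → ℝ} (h : fyS f) (hg : fyS g) : fyS (fun u => f u + g u) := by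
  intro n
  have := (h n).add (hg n)
  simp only [add_zero] at this
  exact this.congr (fun u => by ring)

lemma fyS.mul {f g : ℝ → ℝ} (h : fyS f) (hg : fyS g) : fyS (fun u => f u * g u) := by
  intro n
  have := (h n).mul hg.t0
  simp only [mul_zero] at this
  exact this.congr (fun u => by ring)

lemma fyS.lmul {f : ℝ → ℝ} (h : fyS f) (c : ℝ) (m : ℕ) : fyS (fun u => c * Real.log u ^ m * f u) := by
  intro n
  have := (h (n + m)).const_mul c
  simp only [mul_zero] at this
  exact this.congr (fun u => by ring)

lemma fyS.congr {f g : ℝ → ℝ} (h : fyS f) (hg : ∀ᶠ u in atTop, f u = g u) : fyS g := by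
  intro n
  refine (h n).congr' ?_
  filter_upwards [hg] with u hu
  rw [hu]

lemma fy_log_sqrt {v : ℝ} (hv : 0 < v) : Real.log v ≤ 2 * √v - 2 := by
  have h := Real.log_le_sub_one_of_pos (Real.sqrt_pos.2 hv)
  rw [Real.log_sqrt hv.le] at h
  linarith

lemma fy_inv_le {v : ℝ} (hv : 1 ≤ v) : v⁻¹ ≤ (√v)⁻¹ := by
  have h1 : 1 ≤ √v := Real.one_le_sqrt.2 hv
  have h2 := Real.mul_self_sqrt (show 0 ≤ v by linarith)
  apply inv_anti₀ (by linarith)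
  nlinarith

lemma fy_log_shift {s : ℝ} (hs : 0 < s) : |Real.log s - fyL (s - 1)| ≤ 2 * (√s)⁻¹ := by
  have hq : 0 < √s := Real.sqrt_pos.2 hs
  rcases le_or_gt 2 s with h | h
  · have h1 : s⁻¹ ≤ 1 / 2 := by rw [inv_le_comm₀ hs (by norm_num)]; linarith
    have := fy_log_bound (inv_nonneg.2 hs.le) h1
    rw [fyL_eq (by linarith), abs_sub_comm, ← Real.log_div (by linarith) (by linarith)]
    have e : (s - 1) / s = 1 - s⁻¹ := by field_simp
    rw [e]
    linarith [fy_inv_le (show 1 ≤ s by linarith)]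
  · rw [fyL_zero (by linarith), sub_zero]
    rcases le_total 1 s with h1 | h1
    · rw [abs_of_nonneg (Real.log_nonneg h1)]
      have a := Real.log_le_sub_one_of_pos hs
      have b : √s ≤ 2 := by
        rw [Real.sqrt_le_iff]; constructor <;> linarith
      have : 1 ≤ 2 * (√s)⁻¹ := by
        rw [← div_eq_mul_inv, le_div_iff₀ hq]; linarith
      linarith
    · rw [abs_of_nonpos (Real.log_nonpos hs.le h1), ← Real.log_inv]
      have := fy_log_sqrt (inv_pos.2 hs)
      rw [Real.sqrt_inv] at this
      linarith

lemma fy_rpow_half {t : ℝ} (ht : 0 ≤ t) : t ^ (-(1/2) : ℝ) = (√t)⁻¹ := by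
  rw [Real.rpow_neg ht, Real.sqrt_eq_rpow]

lemma fy_key {ψ : ℝ → ℝ} {C : ℝ} (hm : Measurable ψ) (hb : ∀ t ∈ Ioc (0:ℝ) (1/2), |ψ t| ≤ C) :
    fyS (fun u => (∫ x in (0:ℝ)..(u/2), fyr x * (ψ (x / u) * (x / u)))
      - (Real.log u * (∫ t in (0:ℝ)..(1/2), ψ t) + ∫ t in (0:ℝ)..(1/2), Real.log t * ψ t)) := by
  have hC : 0 ≤ C := (abs_nonneg _).trans (hb (1/2) (by norm_num))
  set K := ∫ t in (0:ℝ)..(1/2), t ^ (-(1/2) : ℝ) with hK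
  apply fyS_of (C := 2 * C * K)
  filter_upwards [eventually_ge_atTop 4] with u hu
  have hu0 : 0 < u := by linarith
  have e1 : (∫ x in (0:ℝ)..(u/2), fyr x * (ψ (x / u) * (x / u)))
      = ∫ t in (0:ℝ)..(1/2), fyL (u * t - 1) * ψ t := by
    have := intervalIntegral.mul_integral_comp_mul_left (a := 0) (b := 1/2)
      (f := fun x => fyr x * (ψ (x / u) * (x / u))) u
    rw [mul_zero, mul_one_div] at this
    rw [← this, ← intervalIntegral.integral_const_mul]
    congr 1
    ext t
    rw [← fy_mul_r, mul_div_cancel_left₀ _ hu0.ne']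
    ring
  have i1 := fy_int_bdd (b := 1/2) (by norm_num) hm hb
  have i2 := fy_int_log (b := 1/2) (by norm_num) hm hb
  have i3 : IntervalIntegrable (fun t => fyL (u * t - 1) * ψ t) volume 0 (1/2) := by
    refine i1.continuousOn_mul ?_
    exact (fyL_cont.comp (by fun_prop)).continuousOn
  rw [e1, ← intervalIntegral.integral_const_mul, ← intervalIntegral.integral_add (i1.const_mul _) i2,
    ← intervalIntegral.integral_sub i3 ((i1.const_mul _).add i2)]
  have i4 : IntervalIntegrable (fun t : ℝ => 2 * C * (√u)⁻¹ * t ^ (-(1/2) : ℝ)) volume 0 (1/2) :=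
    (intervalIntegral.intervalIntegrable_rpow' (by norm_num)).const_mul _
  have := intervalIntegral.norm_integral_le_of_norm_le (f := fun t => fyL (u * t - 1) * ψ t - (Real.log u * ψ t + Real.log t * ψ t)) (show (0:ℝ) ≤ 1/2 by norm_num)
    (Eventually.of_forall ?_) i4
  · rw [intervalIntegral.integral_const_mul, Real.norm_eq_abs] at this
    refine this.trans (le_of_eq ?_)
    rw [hK]; ring
  · intro t ht
    have e2 : fyL (u * t - 1) * ψ t - (Real.log u * ψ t + Real.log t * ψ t)
        = -((Real.log (u * t) - fyL (u * t - 1)) * ψ t) := by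
      rw [Real.log_mul hu0.ne' ht.1.ne']; ring
    rw [e2, norm_neg, norm_mul, Real.norm_eq_abs, Real.norm_eq_abs, fy_rpow_half ht.1.le]
    have h1 := fy_log_shift (mul_pos hu0 ht.1)
    rw [Real.sqrt_mul hu0.le, mul_inv] at h1
    have := mul_le_mul h1 (hb t ht) (abs_nonneg _) (by positivity)
    linarith

lemma fyS.mono {f g : ℝ → ℝ} (h : fyS g) (hg : ∀ᶠ u in atTop, |f u| ≤ g u) : fyS f := by
  intro n
  have h2 := (h n).abs
  rw [abs_zero] at h2
  refine squeeze_zero_norm' ?_ h2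
  filter_upwards [hg] with u hu
  rw [norm_mul, abs_mul, Real.norm_eq_abs, Real.norm_eq_abs]
  exact mul_le_mul_of_nonneg_left (hu.trans (le_abs_self _)) (abs_nonneg _)

lemma fyr_nonneg (x : ℝ) : 0 ≤ fyr x :=
  div_nonneg (Real.log_nonneg (le_max_right _ _)) (fy_max_pos x).le

lemma fyS_inv (c : ℝ) : fyS (fun u => c * u⁻¹) := by
  apply fyS_of (C := |c|)
  filter_upwards [eventually_ge_atTop 1] with u hu
  rw [abs_mul, abs_of_nonneg (inv_nonneg.2 (by linarith : (0:ℝ) ≤ u))]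
  exact mul_le_mul_of_nonneg_left (fy_inv_le hu) (abs_nonneg _)

lemma fyS_Li2 : fyS (fun u => Li 2 (2 / u)) := by
  refine (fyS_inv 4).mono ?_
  filter_upwards [eventually_ge_atTop 4] with u hu
  have h : |2 / u| = 2 / u := abs_of_nonneg (by positivity)
  have := fy_Li_bound 2 (z := 2 / u) (by rw [h, div_le_div_iff₀ (by linarith) (by norm_num)]; linarith)
  rw [h] at this
  refine this.trans (le_of_eq (by ring))

lemma fyp2_half {u : ℝ} (hu : 4 ≤ u) :
    fyp2 (u / 2) = 1 / 2 * (Real.log u - Real.log 2) ^ 2 - zeta' 2 / 2 + Li 2 (2 / u) := by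
  rw [fyp2_eq (by linarith), Real.log_div (by linarith) (by norm_num), one_div_div]
  ring

lemma fy_split {u : ℝ} (hu : 4 ≤ u) :
    |(∫ x in (0:ℝ)..(u/2), fyr x * fyp2 (u - x)) - ((1/2 * Real.log u ^ 2 - zeta' 2 / 2) * fyp2 (u / 2)
      + Real.log u * (∫ x in (0:ℝ)..(u/2), fyr x * (fyψ 0 (x / u) * (x / u)))
      + 1 / 2 * (∫ x in (0:ℝ)..(u/2), fyr x * (fyψ 1 (x / u) * (x / u))))| ≤ 4 * u⁻¹ * fyp2 (u / 2) := by
  have hu0 : 0 < u := by linarith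
  have hψ : ∀ k x, x ∈ Icc 0 (u/2) → fyψ k (x / u) * (x / u) = Real.log (1 - x / u) ^ (k + 1) := by
    intro k x hx
    unfold fyψ
    rcases eq_or_lt_of_le hx.1 with h | h
    · rw [← h]; simp
    · have : x / u ≠ 0 := by positivity
      field_simp
  have huI : uIcc 0 (u/2) = Icc 0 (u/2) := uIcc_of_le (by linarith)
  have hψi : ∀ k, (∫ x in (0:ℝ)..(u/2), fyr x * (fyψ k (x / u) * (x / u)))
      = ∫ x in (0:ℝ)..(u/2), fyr x * Real.log (1 - x / u) ^ (k + 1) := by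
    intro k
    apply intervalIntegral.integral_congr
    intro x hx
    rw [huI] at hx
    simp only [hψ k x hx]
  have hlt : ∀ x ∈ Icc 0 (u/2), 0 < 1 - x / u := by
    intro x hx
    have : x / u ≤ 1 / 2 := by rw [div_le_div_iff₀ hu0 (by norm_num)]; linarith [hx.2]
    linarith
  have hlc : ContinuousOn (fun x => Real.log (1 - x / u)) (uIcc 0 (u/2)) := by
    rw [huI]
    apply ContinuousOn.log (by fun_prop)
    intro x hx; exact (hlt x hx).ne'
  have hrc : ContinuousOn fyr (uIcc 0 (u/2)) := fyr_cont.continuousOn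
  have hpc : ContinuousOn (fun x => fyp2 (u - x)) (uIcc 0 (u/2)) :=
    (fyp2_cont.comp (by fun_prop)).continuousOn
  have j0 : IntervalIntegrable (fun x => fyr x * fyp2 (u - x)) volume 0 (u/2) :=
    (hrc.mul hpc).intervalIntegrable
  have j1 : IntervalIntegrable (fun x => (1/2 * Real.log u ^ 2 - zeta' 2 / 2) * fyr x) volume 0 (u/2) :=
    hrc.intervalIntegrable.const_mul _
  have j2 : IntervalIntegrable (fun x => Real.log u * (fyr x * Real.log (1 - x / u) ^ (0 + 1))) volume 0 (u/2) :=
    (hrc.mul (hlc.pow _)).intervalIntegrable.const_mul _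
  have j3 : IntervalIntegrable (fun x => 1 / 2 * (fyr x * Real.log (1 - x / u) ^ (1 + 1))) volume 0 (u/2) :=
    (hrc.mul (hlc.pow _)).intervalIntegrable.const_mul _
  have j4 : IntervalIntegrable (fun x => 4 * u⁻¹ * fyr x) volume 0 (u/2) :=
    hrc.intervalIntegrable.const_mul _
  have e2 : fyp2 (u / 2) = ∫ x in (0:ℝ)..(u/2), fyr x := rfl
  rw [hψi, hψi, e2, ← intervalIntegral.integral_const_mul, ← intervalIntegral.integral_const_mul,
    ← intervalIntegral.integral_const_mul, ← intervalIntegral.integral_const_mul,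
    ← intervalIntegral.integral_add j1 j2, ← intervalIntegral.integral_add (j1.add j2) j3,
    ← intervalIntegral.integral_sub j0 ((j1.add j2).add j3), ← Real.norm_eq_abs]
  refine intervalIntegral.norm_integral_le_of_norm_le (by linarith) (Eventually.of_forall ?_) j4
  intro x hx
  have hx' : x ∈ Icc 0 (u/2) := ⟨hx.1.le, hx.2⟩
  have hv : 2 ≤ u - x := by linarith [hx.2]
  have hl : Real.log (u - x) = Real.log u + Real.log (1 - x / u) := by
    rw [← Real.log_mul hu0.ne' (hlt x hx').ne']
    congr 1
    field_simp
  have e3 : fyr x * fyp2 (u - x) - ((1/2 * Real.log u ^ 2 - zeta' 2 / 2) * fyr x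
      + Real.log u * (fyr x * Real.log (1 - x / u) ^ (0 + 1)) + 1 / 2 * (fyr x * Real.log (1 - x / u) ^ (1 + 1)))
      = Li 2 (1 / (u - x)) * fyr x := by
    rw [fyp2_eq hv, hl]; ring
  rw [e3, norm_mul, Real.norm_eq_abs, Real.norm_eq_abs, abs_of_nonneg (fyr_nonneg x)]
  refine mul_le_mul_of_nonneg_right ?_ (fyr_nonneg x)
  have h : |1 / (u - x)| = 1 / (u - x) := abs_of_nonneg (by positivity)
  have := fy_Li_bound 2 (z := 1 / (u - x))
    (by rw [h, div_le_div_iff₀ (by linarith) (by norm_num)]; linarith)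
  rw [h] at this
  refine this.trans ?_
  have : 1 / (u - x) ≤ 2 * u⁻¹ := by
    rw [← div_eq_mul_inv, div_le_div_iff₀ (by linarith) hu0]; linarith [hx.2]
  linarith

/-- error of the weight four expansion -/
lemma fyp4_asymp : ∃ a0 b0 a1 : ℝ, ∃ e0 e1 e2 d : ℝ → ℝ, fyS e0 ∧ fyS e1 ∧ fyS e2 ∧ fyS d ∧
    ∀ u, 4 ≤ u → fyp2 (u / 2) = 1 / 2 * (Real.log u - Real.log 2) ^ 2 - zeta' 2 / 2 + e0 u ∧
      (∫ x in (0:ℝ)..(u/2), fyr x * fyp2 (u - x)) =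
        (1/2 * Real.log u ^ 2 - zeta' 2 / 2) * fyp2 (u / 2)
        + Real.log u * (Real.log u * a0 + b0 + e1 u)
        + 1 / 2 * (Real.log u * a1 + (Real.log 2 ^ 4 / 4 - zeta' 4 / 4) + e2 u) + d u := by
  have s1 := fy_key (fyψ_meas 0) (fyψ_bound 0)
  have s2 := fy_key (fyψ_meas 1) (fyψ_bound 1)
  have sd : fyS (fun u => (∫ x in (0:ℝ)..(u/2), fyr x * fyp2 (u - x)) - ((1/2 * Real.log u ^ 2 - zeta' 2 / 2) * fyp2 (u / 2)
      + Real.log u * (∫ x in (0:ℝ)..(u/2), fyr x * (fyψ 0 (x / u) * (x / u)))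
      + 1 / 2 * (∫ x in (0:ℝ)..(u/2), fyr x * (fyψ 1 (x / u) * (x / u))))) := by
    have t0 := (fyS_inv 4)
    have t := (((t0.lmul (1/2) 2).add (t0.lmul (-Real.log 2) 1)).add
      (t0.lmul (1/2 * Real.log 2 ^ 2 - zeta' 2 / 2) 0)).add (t0.mul fyS_Li2)
    refine t.mono ?_
    filter_upwards [eventually_ge_atTop 4] with u hu
    refine (fy_split hu).trans (le_of_eq ?_)
    rw [fyp2_half hu]
    ring
  refine ⟨∫ t in (0:ℝ)..(1/2), fyψ 0 t, ∫ t in (0:ℝ)..(1/2), Real.log t * fyψ 0 t,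
    ∫ t in (0:ℝ)..(1/2), fyψ 1 t, _, _, _, _, fyS_Li2, s1, s2, sd, ?_⟩
  intro u hu
  refine ⟨fyp2_half hu, ?_⟩
  rw [fyJ]
  ring

noncomputable def fyD (v : ℝ) : ℝ := fyp3 v - (1/6 * Real.log v ^ 3 - zeta' 2 / 2 * Real.log v)
noncomputable def fyD' (v : ℝ) : ℝ := fyr3 v - (1/2 * Real.log v ^ 2 - zeta' 2 / 2) / v

lemma fyD_deriv {v : ℝ} (hv : 0 < v) : HasDerivAt fyD (fyD' v) v := by
  have hl := Real.hasDerivAt_log hv.ne'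
  have := (fyp3_deriv v).sub (((hl.pow 3).const_mul (1/6)).sub (hl.const_mul (zeta' 2 / 2)))
  convert! this using 1
  unfold fyD'
  push_cast
  simp
  ring

lemma fyD'_bound {v : ℝ} (hv : 4 ≤ v) : |fyD' v| ≤ 8 * v ^ (-(3/2) : ℝ) := by
  have hv0 : 0 < v := by linarith
  have e : fyD' v = (1/2 * (Real.log (v-1) + Real.log v) * Real.log (1 - v⁻¹) + Li 2 (1 / (v - 1))) / v := by
    have : Real.log (1 - v⁻¹) = Real.log (v - 1) - Real.log v := by
      rw [← Real.log_div (by linarith) hv0.ne']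
      congr 1
      field_simp
    unfold fyD' fyr3
    rw [this, max_eq_left (by linarith), fyp2_eq (by linarith)]
    ring
  have h1 : v⁻¹ ≤ 1 / 2 := by rw [inv_le_comm₀ hv0 (by norm_num)]; linarith
  have b1 := fy_log_bound (inv_nonneg.2 hv0.le) h1
  have h : |1 / (v - 1)| = 1 / (v - 1) := abs_of_nonneg (one_div_nonneg.2 (by linarith))
  have b2 := fy_Li_bound 2 (z := 1 / (v - 1))
    (by rw [h, div_le_div_iff₀ (by linarith) (by norm_num)]; linarith)
  rw [h] at b2
  have b3 : 1 / (v - 1) ≤ 2 * v⁻¹ := by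
    rw [← div_eq_mul_inv, div_le_div_iff₀ (by linarith) hv0]; linarith
  have b4 : 0 ≤ Real.log (v - 1) := Real.log_nonneg (by linarith)
  have b5 : Real.log (v - 1) ≤ Real.log v := Real.log_le_log (by linarith) (by linarith)
  have b6 := fy_log_sqrt hv0
  have hs : v ^ (-(3/2) : ℝ) = (√v)⁻¹ * v⁻¹ := by
    rw [← fy_rpow_half hv0.le, ← Real.rpow_neg_one v, ← Real.rpow_add hv0]; norm_num
  have hi : v⁻¹ * √v = (√v)⁻¹ := by
    have := Real.mul_self_sqrt hv0.le
    have h2 : 0 < √v := Real.sqrt_pos.2 hv0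
    field_simp
    rw [pow_two, this]
  have hp : 0 < v⁻¹ := inv_pos.2 hv0
  rw [e, hs, abs_div, abs_of_pos hv0, div_eq_mul_inv, ← mul_assoc]
  refine mul_le_mul_of_nonneg_right ?_ hp.le
  refine (abs_add_le _ _).trans ?_
  rw [abs_mul, abs_of_nonneg (show 0 ≤ 1/2 * (Real.log (v-1) + Real.log v) by linarith)]
  have c1 : 1/2 * (Real.log (v-1) + Real.log v) * |Real.log (1 - v⁻¹)| ≤ (2 * √v - 2) * (2 * v⁻¹) :=
    mul_le_mul (by linarith) b1 (abs_nonneg _) (by linarith)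
  nlinarith

lemma fyD_asymp : ∃ c : ℝ, ∀ v, 4 ≤ v → |fyD v - c| ≤ 16 * (√v)⁻¹ := by
  have hI : ∀ v : ℝ, 4 ≤ v → IntegrableOn (fun x : ℝ => 8 * x ^ (-(3/2) : ℝ)) (Ioi v) := fun v hv =>
    (integrableOn_Ioi_rpow_of_lt (by norm_num) (by linarith)).const_mul 8
  have hm : Measurable fyD' := by
    unfold fyD'
    have := fyr3_cont.measurable
    fun_prop
  have hI' : ∀ v : ℝ, 4 ≤ v → IntegrableOn fyD' (Ioi v) := fun v hv => by
    refine (hI v hv).mono' hm.aestronglyMeasurable ?_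
    filter_upwards [ae_restrict_mem measurableSet_Ioi] with x hx
    exact fyD'_bound (hv.trans (le_of_lt hx))
  have hlim := tendsto_limUnder_of_hasDerivAt_of_integrableOn_Ioi (a := 4)
    (fun x hx => fyD_deriv (lt_trans (by norm_num) hx)) (hI' 4 le_rfl)
  refine ⟨limUnder atTop fyD, fun v hv => ?_⟩
  have := integral_Ioi_of_hasDerivAt_of_tendsto (a := v)
    (fyD_deriv (by linarith)).continuousAt.continuousWithinAt
    (fun x hx => fyD_deriv (lt_trans (by linarith) hx)) (hI' v hv) hlim
  rw [abs_sub_comm, ← this, ← Real.norm_eq_abs]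
  refine (norm_integral_le_of_norm_le (hI v hv) ?_).trans ?_
  · filter_upwards [ae_restrict_mem measurableSet_Ioi] with x hx
    exact fyD'_bound (hv.trans (le_of_lt hx))
  · rw [integral_const_mul, integral_Ioi_rpow_of_lt (by norm_num) (by linarith), ← fy_rpow_half (by linarith)]
    norm_num
    linarith

lemma fy_poly {K a b c : ℝ}
    (h : Tendsto (fun u : ℝ => K - (a * Real.log u ^ 2 + b * Real.log u + c)) atTop (𝓝 0)) : K = c := by
  have h0 := h.comp Real.tendsto_exp_atTop
  simp only [Function.comp_def, Real.log_exp] at h0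
  have hi : Tendsto (fun x : ℝ => x⁻¹) atTop (𝓝 0) := tendsto_inv_atTop_zero
  have ha : a = 0 := by
    have h1 := h0.mul (hi.pow 2)
    have h2 := ((hi.pow 2).const_mul (K - c)).sub (hi.const_mul b) |>.sub_const a
    have h3 := h2.congr' (f₂ := fun x => (K - (a * x ^ 2 + b * x + c)) * x⁻¹ ^ 2) (by
      filter_upwards [eventually_gt_atTop 0] with x hx
      field_simp; ring)
    have := tendsto_nhds_unique h1 h3
    norm_num at this
    linarith
  subst ha
  have hb : b = 0 := by
    have h1 := h0.mul hi
    have h2 := (hi.const_mul (K - c)).sub_const b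
    have h3 := h2.congr' (f₂ := fun x => (K - (0 * x ^ 2 + b * x + c)) * x⁻¹) (by
      filter_upwards [eventually_gt_atTop 0] with x hx
      field_simp; ring)
    have := tendsto_nhds_unique h1 h3
    norm_num at this
    linarith
  subst hb
  have := tendsto_nhds_unique h0 (tendsto_const_nhds.congr (fun x : ℝ => show K - c = _ by ring))
  linarith

lemma fy_logshift {k : ℝ} (hk : 1 ≤ k) : fyS (fun u => Real.log (u - k) - Real.log u) := by
  refine (fyS_inv (2 * k)).mono ?_
  filter_upwards [eventually_ge_atTop (4 * k)] with u hu
  have hu0 : 0 < u := by linarith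
  have h1 : k / u ≤ 1 / 2 := by rw [div_le_div_iff₀ hu0 (by norm_num)]; linarith
  have := fy_log_bound (div_nonneg (by linarith) hu0.le) h1
  rw [← Real.log_div (by linarith) hu0.ne']
  have e : (u - k) / u = 1 - k / u := by field_simp
  rw [e]
  refine this.trans (le_of_eq (by ring))

noncomputable def fyη (y : ℝ) : ℝ := - 3 * Li 4 (-y) + 3 * Li 3 (-y) * Real.log y
    - (3 / 2) * Li 2 (-y) * (Real.log y) ^ 2
    + (1 / 2) * Li 1 (-y) * (Real.log y) ^ 3

lemma fyη_zero : Tendsto fyη (𝓝[>] 0) (𝓝 0) := by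
  have e1 := fy_tl 3 _ _ (fy_Li_mul_bound 1 (1/2) (-1) (by norm_num))
  have e2 := fy_tl 2 _ _ (fy_Li_mul_bound 2 (3/2) (-1) (by norm_num))
  have e3 := fy_tl 1 _ _ (fy_Li_mul_bound 3 3 (-1) (by norm_num))
  have e4 := fy_tl 0 _ _ (fy_Li_mul_bound 4 3 (-1) (by norm_num))
  have := ((e1.sub e2).add e3).sub e4
  simp only [sub_zero, add_zero] at this
  refine this.congr ?_
  intro t
  simp only [fyη, neg_one_mul, pow_one, pow_zero]
  ring

lemma fy_inv_shift (k : ℝ) : Tendsto (fun u : ℝ => 1 / (u - k)) atTop (𝓝[>] 0) := by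
  have h : Tendsto (fun u : ℝ => u - k) atTop atTop := tendsto_atTop_add_const_right _ (-k) tendsto_id
  have := tendsto_inv_atTop_nhdsGT_zero.comp h
  exact this.congr (fun u => by simp)

lemma fyF_const {u : ℝ} (hu : 4 ≤ u) : fyF u = fyF 4 :=
  fy_const hu (fun x hx => (fyF_deriv hx.1).continuousAt.continuousWithinAt)
    (fun x hx => fyF_deriv hx.1.le)

lemma fyF_zero : 6 * fyF 4 = 0 := by
  obtain ⟨a0, b0, a1, e0, e1, e2, d, s0, s1, s2, sd, hmain⟩ := fyp4_asymp
  obtain ⟨c3, hc3⟩ := fyD_asymp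
  have sg : fyS (fun u => fyD (u - 1) - c3) := by
    apply fyS_of (C := 32)
    filter_upwards [eventually_ge_atTop 5] with u hu
    refine (hc3 (u - 1) (by linarith)).trans ?_
    have h1 : 0 < √(u - 1) := Real.sqrt_pos.2 (by linarith)
    have h2 : √u ≤ 2 * √(u - 1) := by
      rw [Real.sqrt_le_iff]
      refine ⟨by linarith, ?_⟩
      rw [mul_pow, Real.sq_sqrt (by linarith)]; linarith
    have h3 : 0 < √u := Real.sqrt_pos.2 (by linarith)
    rw [← div_eq_mul_inv, ← div_eq_mul_inv, div_le_div_iff₀ h1 h3]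
    linarith
  have t1 := fy_logshift (k := 1) le_rfl
  have t2 := fy_logshift (k := 2) (by norm_num)
  set l := Real.log 2 with hl
  set z := zeta' 2 with hz
  have S1 := ((s0.lmul (2 * l) 1).add (s0.lmul (-l ^ 2) 0)).add ((s0.mul s0).lmul (-1) 0)
  have S2 := ((s1.lmul 2 1).add s2).add ((sd.lmul 2 0).add (sg.lmul (-6) 1))
  have S3 := ((t1.lmul (-3) 3).add ((t1.mul t1).lmul (-3) 2)).add
    ((((t1.mul t1).mul t1).lmul (-1) 1).add (t1.lmul (3 * z) 1))
  have S4 := ((t2.lmul 3 3).add ((t2.mul t2).lmul (9/2) 2)).add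
    ((((t2.mul t2).mul t2).lmul 3 1).add (((t2.mul t2).mul (t2.mul t2)).lmul (3/4) 0))
  have S := ((S1.add S2).add (S3.add S4)).t0
  have hLi : Tendsto (fun u : ℝ => Li 2 (1 - 1 / (u - 0))) atTop (𝓝 z) :=
    (fy_Li_one_tendsto 2 le_rfl).comp (fy_inv_shift 0)
  have hη := (fyη_zero.comp (fy_inv_shift 2)).const_mul 6
  have hH := (fyH_zero.comp (fy_inv_shift 2)).const_mul 6
  have T := ((S.add ((hLi.sub_const z).const_mul (-3 * z))).add hη).add hH
  simp only [sub_self, mul_zero, add_zero, Function.comp_def] at T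
  set m := l ^ 2 / 2 - z / 2 with hm
  have hfin := fy_poly (K := 6 * fyF 4) (a := -l^2 - z/2 + 2 * a0 + 3 * z - 3/2 * z)
    (b := l * m + l * (z + m) + 2 * b0 + a1 - 6 * c3)
    (c := -(z + m) * m + (l ^ 4 / 4 - zeta' 4 / 4) - 3 * z ^ 2 + 57 / 8 * zeta' 4) (T.congr' ?_)
  · rw [hfin, hm]
    have := fy_zeta_sq
    rw [← hz] at this
    linear_combination (-11/4) * this
  · filter_upwards [eventually_ge_atTop 5] with u hu
    rw [← fyF_const (u := u) (by linarith)]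
    obtain ⟨h1, h2⟩ := hmain u (by linarith)
    have h3 := fy_half (u := u) (by linarith)
    rw [h2, h1] at h3
    have hE : E4 (1 / (u - 2)) = 19 / 16 * zeta' 4 + fyη (1 / (u - 2)) + 1 / 8 * Real.log (u - 2) ^ 4 := by
      have : Real.log (1 / (u - 2)) ^ 4 = Real.log (u - 2) ^ 4 := by
        rw [one_div, Real.log_inv]; ring
      rw [← this]
      unfold E4 fyη
      ring
    have hp3 : fyp3 (u - 1) = fyD (u - 1) + (1/6 * Real.log (u - 1) ^ 3 - z / 2 * Real.log (u - 1)) := by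
      unfold fyD; ring
    unfold fyF
    rw [hE, hp3, sub_zero, ← hz, hm]
    linear_combination -h3

end

/-- Theorem 5: For every real `u ≥ 4`, with `y = 1/(u−2)`, the Furry
probability of weight four satisfies
`P₄(u) = P₃(u−1)·log(u) + (ζ(2)/4)·(2·Li₂(1−1/u) + log²(u)) − E₄(y) − H₄(y)`. -/
theorem furry_P4
    (P : ℕ → ℝ → ℝ)
    (hP0 : ∀ u : ℝ, 0 ≤ u → P 0 u = 1)
    (hPcont : ∀ k : ℕ, ContinuousOn (P (k + 1)) (Set.Ici ((k : ℝ) + 1)))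
    (hPinit : ∀ k : ℕ, P (k + 1) ((k : ℝ) + 1) = 0)
    (hPderiv : ∀ k : ℕ, ∀ u : ℝ, (k : ℝ) + 1 < u →
      HasDerivAt (P (k + 1)) (P k (u - 1) / u) u) :
    ∀ u : ℝ, 4 ≤ u →
      P 4 u = P 3 (u - 1) * Real.log u
        + (zeta' 2 / 4) * (2 * Li 2 (1 - 1 / u) + (Real.log u) ^ 2)
        - E4 (1 / (u - 2)) - H4 (1 / (u - 2)) := by
  have step : ∀ (k : ℕ) (g r : ℝ → ℝ), ContinuousOn g (Set.Ici ((k : ℝ) + 1)) → g ((k : ℝ) + 1) = 0 →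
      (∀ u : ℝ, (k : ℝ) + 1 < u → HasDerivAt g (r u) u) →
      (∀ u : ℝ, (k : ℝ) + 1 < u → P k (u - 1) / u = r u) →
      ∀ u : ℝ, (k : ℝ) + 1 ≤ u → P (k + 1) u = g u := by
    intro k g r hc h0 hd hr u hu
    have := fy_const (f := fun x => P (k + 1) x - g x) hu
      (((hPcont k).sub hc).mono (fun x hx => hx.1))
      (fun x hx => by
        have := (hPderiv k x hx.1).sub (hd x hx.1)
        rw [hr x hx.1, sub_self] at this
        exact this)
    simp only [hPinit k, h0, sub_self] at this
    linarith
  have q1 : ∀ u : ℝ, 1 ≤ u → P 1 u = Real.log u := by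
    intro u hu
    refine step 0 Real.log (fun x => x⁻¹) ?_ (by simp) ?_ ?_ u (by simpa using hu)
    · intro x hx
      have : (1:ℝ) ≤ x := by simpa using hx
      exact (Real.continuousAt_log (by linarith)).continuousWithinAt
    · intro x hx
      have : (1:ℝ) < x := by simpa using hx
      exact Real.hasDerivAt_log (by linarith)
    · intro x hx
      have : (1:ℝ) < x := by simpa using hx
      rw [hP0 _ (by linarith), one_div]
  have q2 : ∀ u : ℝ, 2 ≤ u → P 2 u = fyp2 u := by
    intro u hu
    refine step 1 fyp2 fyr fyp2_cont.continuousOn (fyp2_zero (by norm_num)) (fun x _ => fyp2_deriv x)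
      ?_ u (by norm_num; exact hu)
    intro x hx
    have : (2:ℝ) < x := by norm_num at hx; exact hx
    rw [q1 _ (by linarith), fyr_eq this.le]
  have q3 : ∀ u : ℝ, 3 ≤ u → P 3 u = fyp3 u := by
    intro u hu
    refine step 2 fyp3 fyr3 fyp3_cont.continuousOn (fyp3_zero (by norm_num)) (fun x _ => fyp3_deriv x)
      ?_ u (by norm_num; exact hu)
    intro x hx
    have : (3:ℝ) < x := by norm_num at hx; exact hx
    rw [q2 _ (by linarith), fyr3, max_eq_left (by linarith)]
  have q4 : ∀ u : ℝ, 4 ≤ u → P 4 u = fyp4 u := by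
    intro u hu
    refine step 3 fyp4 fyr4 fyp4_cont.continuousOn (fyp4_zero (by norm_num)) (fun x _ => fyp4_deriv x)
      ?_ u (by norm_num; exact hu)
    intro x hx
    have : (4:ℝ) < x := by norm_num at hx; exact hx
    rw [q3 _ (by linarith), fyr4, max_eq_left (by linarith)]
  intro u hu
  have hF : fyF u = 0 := by
    rw [fyF_const hu]; linarith [fyF_zero]
  have hy : 1 / (u - 2) ≤ 1 / 2 := one_div_le_one_div_of_le (by norm_num) (by linarith)
  have hy0 : 0 ≤ 1 / (u - 2) := one_div_nonneg.2 (by linarith)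
  rw [q4 u hu, q3 _ (by linarith), fyH4_eq hy0 hy]
  unfold fyF at hF
  linarith
end

section
/- For all integers n > j > 0, the function y ↦ M_{j,n}(y) is differentiable on (0,1) and satisfies the differential-delay relation (n−y)·M′_{j,n}(y) = M_{j−1,n−1}(y), where M_{0,m}(y) = 1 by convention. -/
/-- The multiple polylogarithm `M_{j,n}(y)`: the nested sum over strictly decreasing
tuples `n₁ > n₂ > … > n_j > 0` of `∏ᵢ zᵢ^{nᵢ}/nᵢ`, where `z₁ = y/n` and
`zᵢ = (n+2−i)/(n+1−i)` for `1 < i ≤ j`. For `j = 0` the empty product makes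
`M_{0,n}(y) = 1`, as required by the convention. -/
noncomputable def M (j n : ℕ) (y : ℝ) : ℝ :=
  ∑' f : {f : Fin j → ℕ // StrictAnti f ∧ ∀ i, 0 < f i},
    ∏ i : Fin j,
      (if (i : ℕ) = 0 then y / n else ((n : ℝ) + 1 - (i : ℕ)) / ((n : ℝ) - (i : ℕ))) ^ (f.1 i)
        / (f.1 i : ℝ)

abbrev Tup (j : ℕ) := {f : Fin j → ℕ // StrictAnti f ∧ ∀ i, 0 < f i}

def hdT {j : ℕ} (g : Fin j → ℕ) : ℕ := if h : 0 < j then g ⟨0, h⟩ else 0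

noncomputable def T (j n : ℕ) (y : ℝ) (f : Tup j) : ℝ :=
    ∏ i : Fin j,
      (if (i : ℕ) = 0 then y / n else ((n : ℝ) + 1 - (i : ℕ)) / ((n : ℝ) - (i : ℕ))) ^ (f.1 i)
        / (f.1 i : ℝ)

noncomputable def R (j n : ℕ) (f : Fin j → ℕ) : ℝ :=
    ∏ i : Fin j, (((n : ℝ) - (i : ℕ)) / ((n : ℝ) - ((i : ℕ) + 1))) ^ (f i) / (f i : ℝ)

noncomputable def D (j n : ℕ) (y : ℝ) (f : Tup (j+1)) : ℝ :=
    (y / n) ^ (f.1 0 - 1) * (1 / n) * R j n (fun i => f.1 i.succ)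

lemma T_succ (j n : ℕ) (y : ℝ) (f : Tup (j+1)) :
    T (j+1) n y f = (y / n) ^ (f.1 0) / (f.1 0 : ℝ) * R j n (fun i => f.1 i.succ) := by
  unfold T R
  rw [Fin.prod_univ_succ]
  congr 1
  apply Finset.prod_congr rfl
  intro i _
  have : ((i.succ : Fin (j+1)) : ℕ) ≠ 0 := by simp
  rw [if_neg this]
  congr 3
  · push_cast [Fin.val_succ]; ring
  · push_cast [Fin.val_succ]; ring

lemma T_eq_R (j m : ℕ) (hm : 0 < m) (y : ℝ) (g : Tup j) :
    T j m y g = (y / (m + 1 : ℕ)) ^ (hdT g.1) * R j (m+1) g.1 := by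
  cases j with
  | zero => simp [T, R, hdT]
  | succ j =>
    rw [T_succ]
    have h0 : hdT g.1 = g.1 0 := by simp [hdT]
    rw [h0]
    unfold R
    rw [Fin.prod_univ_succ (n := j)]
    have hm' : (m : ℝ) ≠ 0 := by positivity
    have e1 : (y / m) ^ (g.1 0) / (g.1 0 : ℝ) = (y / (m + 1 : ℕ)) ^ (g.1 0) *
       (((((m + 1 : ℕ) : ℝ) - ((0 : Fin (j+1)) : ℕ)) / (((m + 1 : ℕ) : ℝ) - (((0 : Fin (j+1)) : ℕ) + 1))) ^ (g.1 0) / (g.1 0 : ℝ)) := by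
      rw [← mul_div_assoc, ← mul_pow]
      congr 2
      push_cast
      have : (m : ℝ) + 1 ≠ 0 := by positivity
      simp
      field_simp
    rw [e1, mul_assoc]
    congr 2
    apply Finset.prod_congr rfl
    intro i _
    congr 3
    · push_cast [Fin.val_succ]; ring
    · push_cast [Fin.val_succ]; ring

lemma R_nonneg (j n : ℕ) (h : j < n) (f : Fin j → ℕ) : 0 ≤ R j n f := by
  unfold R
  apply Finset.prod_nonneg
  intro i _
  have : ((i : ℕ) : ℝ) + 1 ≤ n := by exact_mod_cast (by omega)
  have h1 : (0:ℝ) ≤ (n : ℝ) - (i : ℕ) := by linarith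
  have h2 : (0:ℝ) ≤ (n : ℝ) - ((i : ℕ) + 1) := by linarith
  positivity

lemma T_deriv (j n : ℕ) (y : ℝ) (f : Tup (j+1)) :
    HasDerivAt (fun t => T (j+1) n t f) (D j n y f) y := by
  simp only [T_succ]
  unfold D
  apply HasDerivAt.mul_const
  have h := (((hasDerivAt_id y).div_const (n:ℝ)).pow (f.1 0)).div_const (f.1 0 : ℝ)
  have : (f.1 0 : ℝ) ≠ 0 := by exact_mod_cast (f.2.2 0).ne'
  refine HasDerivAt.congr_deriv h ?_
  simp only [id]
  symm
  rw [eq_div_iff this]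
  ring

lemma le_hdT {j : ℕ} (g : Tup j) (i : Fin j) : g.1 i ≤ hdT g.1 := by
  have h : 0 < j := i.pos
  simp only [hdT, h, dite_true]
  exact g.2.1.antitone (Fin.mk_le_of_le_val (Nat.zero_le _))

lemma hdT_lt {j : ℕ} (f : Tup (j+1)) : hdT (fun i => f.1 (Fin.succ i)) < f.1 0 := by
  unfold hdT
  split_ifs with h
  · exact f.2.1 (Fin.succ_pos _)
  · exact f.2.2 0

def eT (j : ℕ) : Tup j × ℕ ≃ Tup (j+1) where
  toFun p := ⟨Fin.cons (hdT p.1.1 + p.2 + 1) p.1.1, by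
    constructor
    · intro a b
      refine Fin.cases ?_ (fun a => ?_) a <;> refine Fin.cases ?_ (fun b => ?_) b
      · simp
      · intro _
        have := le_hdT p.1 b
        simp only [Fin.cons_zero, Fin.cons_succ]; omega
      · intro h; simp at h
      · intro h
        simp only [Fin.cons_succ]
        exact p.1.2.1 (by simpa using h)
    · intro i
      refine Fin.cases ?_ (fun a => ?_) i
      · simp
      · simpa using p.1.2.2 a⟩
  invFun f := (⟨fun i => f.1 i.succ, fun a b h => f.2.1 (by simpa using h), fun i => f.2.2 _⟩,
    f.1 0 - 1 - hdT (fun i => f.1 (Fin.succ i)))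
  left_inv p := by
    ext
    · simp
    · simp
  right_inv f := by
    ext i
    refine Fin.cases ?_ (fun a => ?_) i
    · have := hdT_lt f
      simp only [Fin.cons_zero]; omega
    · simp

lemma D_eT (j m : ℕ) (hm : 0 < m) (y : ℝ) (p : Tup j × ℕ) :
    D j (m+1) y (eT j p) = T j m y p.1 * ((1 / (m+1 : ℕ)) * (y / (m+1 : ℕ)) ^ p.2) := by
  rw [T_eq_R j m hm]
  simp only [D, eT, Equiv.coe_fn_mk, Fin.cons_zero, Fin.cons_succ, Nat.add_sub_cancel, pow_add]
  ring

lemma T_nonneg (j m : ℕ) (h : j < m) (y : ℝ) (hy : 0 ≤ y) (g : Tup j) : 0 ≤ T j m y g := by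
  rw [T_eq_R j m (by omega)]
  have := R_nonneg j (m+1) (by omega) g.1
  positivity

lemma D_hasSum (j m : ℕ) (h : j < m) (y : ℝ) (hy : 0 ≤ y) (hy1 : y ≤ 1)
    (hs : Summable (T j m y)) :
    HasSum (D j (m+1) y) ((∑' g, T j m y g) * (1 / ((m+1 : ℕ) - y))) := by
  rw [← (eT j).hasSum_iff]
  have hm : (1:ℝ) ≤ m := by exact_mod_cast (by omega)
  have hlt : y / (m+1 : ℕ) < 1 := by
    rw [div_lt_one (by positivity)]; push_cast; linarith
  have hg := (hasSum_geometric_of_lt_one (by positivity) hlt).mul_left (1 / ((m+1 : ℕ) : ℝ))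
  have hg' : (1 / ((m+1 : ℕ) : ℝ)) * (1 - y / (m+1 : ℕ))⁻¹ = 1 / ((m+1 : ℕ) - y) := by
    have : ((m+1 : ℕ) : ℝ) ≠ 0 := by positivity
    rw [one_div, one_div, ← mul_inv]
    congr 1
    field_simp
  rw [hg'] at hg
  have hsum := hs.mul_of_nonneg hg.summable (fun g => T_nonneg j m h y hy g)
    (fun k => by positivity)
  have := hs.hasSum.mul hg hsum
  have he : D j (m+1) y ∘ (eT j) = fun p : Tup j × ℕ =>
      T j m y p.1 * ((1 / (m+1 : ℕ)) * (y / (m+1 : ℕ)) ^ p.2) :=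
    funext fun p => D_eT j m (by omega) y p
  rw [he]
  exact this

lemma T_le_D (j n : ℕ) (h : j + 1 < n) (y : ℝ) (hy : 0 ≤ y) (hy1 : y ≤ 1) (f : Tup (j+1)) :
    T (j+1) n y f ≤ D j n y f := by
  rw [T_succ, D]
  apply mul_le_mul_of_nonneg_right _ (R_nonneg j n (by omega) _)
  have h0 := f.2.2 0
  obtain ⟨k, hk⟩ : ∃ k, f.1 0 = k + 1 := ⟨f.1 0 - 1, by omega⟩
  rw [hk, pow_succ, Nat.add_sub_cancel]
  have hn : (0:ℝ) < n := by exact_mod_cast (by omega)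
  rw [mul_div_assoc]
  apply mul_le_mul_of_nonneg_left _ (by positivity)
  have : (1:ℝ) ≤ (k+1 : ℕ) := by exact_mod_cast (by omega)
  calc y / n / (k+1 : ℕ) ≤ y / n := div_le_self (by positivity) this
    _ ≤ 1 / n := by gcongr

lemma T_summable (j : ℕ) : ∀ m, j < m → ∀ y : ℝ, 0 ≤ y → y ≤ 1 → Summable (T j m y) := by
  induction j with
  | zero =>
    intro m _ y _ _
    have : Finite (Tup 0) := inferInstance
    exact Summable.of_finite
  | succ j ih =>
    intro m hm y hy hy1
    obtain ⟨k, rfl⟩ : ∃ k, m = k + 1 := ⟨m - 1, by omega⟩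
    exact (D_hasSum j k (by omega) y hy hy1 (ih k (by omega) y hy hy1)).summable.of_nonneg_of_le
      (fun f => T_nonneg _ _ hm y hy f) (fun f => T_le_D j _ hm y hy hy1 f)

/-- For all integers `n > j > 0`, the function `y ↦ M_{j,n}(y)` is
differentiable on `(0,1)` and satisfies `(n−y)·M′_{j,n}(y) = M_{j−1,n−1}(y)`. -/
theorem M_differential_delay :
    ∀ n j : ℕ, 0 < j → j < n → ∀ y : ℝ, 0 < y → y < 1 →
      ∃ d : ℝ, HasDerivAt (fun t : ℝ => M j n t) d y ∧
        ((n : ℝ) - y) * d = M (j - 1) (n - 1) y := by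
  intro n j hj hjn y hy hy1
  obtain ⟨j, rfl⟩ : ∃ k, j = k + 1 := ⟨j - 1, by omega⟩
  obtain ⟨m, rfl⟩ : ∃ k, n = k + 1 := ⟨n - 1, by omega⟩
  have hjm : j < m := by omega
  refine ⟨∑' f, D j (m+1) y f, ?_, ?_⟩
  · have hu := (D_hasSum j m hjm 1 zero_le_one le_rfl
      (T_summable j m hjm 1 zero_le_one le_rfl)).summable
    have := hasDerivAt_tsum_of_isPreconnected (g := fun f t => T (j+1) (m+1) t f)
      (g' := fun f t => D j (m+1) t f) (y₀ := y) hu (isOpen_Ioo (a := (0:ℝ)) (b := 1))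
      isPreconnected_Ioo (fun f t _ => T_deriv j (m+1) t f)
      (fun f t ht => by
        have hR := R_nonneg j (m+1) (by omega) (fun i => f.1 i.succ)
        have h0 := ht.1.le
        have h1 := ht.2.le
        unfold D
        rw [Real.norm_of_nonneg (by positivity)]
        gcongr) ⟨hy, hy1⟩
      (T_summable (j+1) (m+1) hjn y hy.le hy1.le) ⟨hy, hy1⟩
    exact this
  · rw [(D_hasSum j m hjm y hy.le hy1.le (T_summable j m hjm y hy.le hy1.le)).tsum_eq]
    have hm : (0:ℝ) ≤ m := by positivity
    have : (((m+1 : ℕ) : ℝ) - y) ≠ 0 := by push_cast; linarith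
    change _ = ∑' g, T j m y g
    field_simp
end

section
/- The dilogarithm identity (1/2)·(log²(3) − ζ(2)) + Li_2(1/3) = log(2)·log(3/2) − (1/2)·Li_2(1/4) holds; equivalently, the Furry probability of weight two satisfies P_2(3) = log(2)·log(3/2) − (1/2)·Li_2(1/4). -/
noncomputable def SS (z : ℝ) : ℝ := ∑' n : ℕ, z ^ n / ((n : ℝ) + 1)

theorem const_aux {f : ℝ → ℝ} {a b : ℝ} (hab : a < b) (hc : ContinuousOn f (Set.Icc a b))
    (hd : ∀ x ∈ Set.Ioo a b, HasDerivAt f 0 x) : f b = f a := by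
  obtain ⟨c, hc, h⟩ := exists_hasDerivAt_eq_slope f (fun _ => 0) hab hc hd
  have : b - a ≠ 0 := by linarith
  field_simp at h
  linarith

theorem SS_mul {z : ℝ} (hz : |z| < 1) : z * SS z = - Real.log (1 - z) := by
  rw [← (Real.hasSum_pow_div_log_of_abs_lt_one hz).tsum_eq, SS, ← tsum_mul_left]
  congr 1; ext n; ring

theorem SS_eq {z : ℝ} (hz : |z| < 1) (h0 : z ≠ 0) : SS z = - Real.log (1 - z) / z := by
  rw [← SS_mul hz]; field_simp

theorem term_bound (n : ℕ) {z r : ℝ} (hz : |z| ≤ r) : ‖z ^ n / ((n : ℝ) + 1)‖ ≤ r ^ n := by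
  have h1 : (0:ℝ) ≤ n := Nat.cast_nonneg n
  rw [norm_div, norm_pow, Real.norm_eq_abs, Real.norm_eq_abs, abs_of_pos (by linarith : (0:ℝ) < n + 1)]
  have h2 : |z| ^ n ≤ r ^ n := pow_le_pow_left₀ (abs_nonneg z) hz n
  have h3 : 0 ≤ |z| ^ n := by positivity
  refine (div_le_self h3 (by linarith)).trans h2

theorem SS_cont : ContinuousOn SS (Set.Icc (-(1/2)) (1/2)) := by
  unfold SS
  refine continuousOn_tsum (u := fun n => (1/2 : ℝ) ^ n) (fun n => by fun_prop)
    (summable_geometric_of_lt_one (by norm_num) (by norm_num)) ?_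
  intro n x hx
  exact term_bound n (abs_le.2 ⟨hx.1, hx.2⟩)

theorem sum_aux : Summable (fun n : ℕ => 1 / ((n : ℝ) + 1) ^ 2) := by
  have := (summable_nat_add_iff 1).2 (Real.summable_one_div_nat_pow.2 (by norm_num : 1 < 2))
  simpa using this

theorem Li_bound (n : ℕ) {z : ℝ} (hz : |z| ≤ 1) :
    ‖z ^ (n+1) / ((n : ℝ) + 1) ^ 2‖ ≤ 1 / ((n : ℝ) + 1) ^ 2 := by
  rw [norm_div, norm_pow, Real.norm_eq_abs, Real.norm_eq_abs, abs_of_nonneg (by positivity : (0:ℝ) ≤ (n + 1)^2)]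
  have h2 : |z| ^ (n+1) ≤ 1 := pow_le_one₀ (abs_nonneg z) hz
  gcongr

theorem Li_summable {z : ℝ} (hz : |z| ≤ 1) :
    Summable (fun n : ℕ => z ^ (n+1) / ((n : ℝ) + 1) ^ 2) :=
  Summable.of_norm_bounded sum_aux (fun n => Li_bound n hz)

theorem Li_cont : ContinuousOn (Li 2) (Set.Icc (-1) 1) := by
  unfold Li
  refine continuousOn_tsum (fun n => by fun_prop) sum_aux ?_
  intro n x hx
  exact Li_bound n (abs_le.2 ⟨hx.1, hx.2⟩)

theorem Li_zero : Li 2 0 = 0 := by simp [Li]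

theorem Li_deriv {z : ℝ} (hz : |z| < 1) : HasDerivAt (Li 2) (SS z) z := by
  obtain ⟨r, h1, h2⟩ := exists_between hz
  have hr : 0 < r := (abs_nonneg z).trans_lt h1
  unfold Li SS
  refine hasDerivAt_tsum_of_isPreconnected (u := fun n : ℕ => r ^ n) (t := Set.Ioo (-r) r) (y₀ := 0)
    (g := fun (n : ℕ) z => z ^ (n+1) / ((n : ℝ) + 1) ^ 2) (g' := fun (n : ℕ) z => z ^ n / ((n : ℝ) + 1))
    (summable_geometric_of_lt_one hr.le h2) isOpen_Ioo isPreconnected_Ioo ?_ ?_ ?_ ?_ ?_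
  · intro n y hy
    have := (hasDerivAt_pow (n+1) y).div_const (((n : ℝ) + 1) ^ 2)
    refine this.congr_deriv ?_
    have : (n : ℝ) + 1 ≠ 0 := by positivity
    push_cast
    try simp only [Nat.add_sub_cancel]
    field_simp
    try simp
  · intro n y hy
    exact term_bound n (abs_lt.2 ⟨hy.1, hy.2⟩).le
  · simp [hr]
  · exact Li_summable (by simp)
  · exact ⟨(abs_lt.1 h1).1, (abs_lt.1 h1).2⟩

theorem Li_deriv' {z : ℝ} (hz : |z| < 1) (h0 : z ≠ 0) :
    HasDerivAt (Li 2) (- Real.log (1 - z) / z) z := by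
  rw [← SS_eq hz h0]; exact Li_deriv hz

theorem Li_half : 2 * Li 2 (1/2) = Li 2 1 - Real.log 2 ^ 2 := by
  have key := const_aux (f := fun x => Li 2 x + Li 2 (1 - x) - (x * Real.log x) * SS x)
    (a := 0) (b := 1/2) (by norm_num) ?_ ?_
  · have h := SS_mul (z := 1/2) (by rw [abs_of_pos] <;> norm_num)
    have e : (1:ℝ) - 1/2 = 1/2 := by norm_num
    have e2 : Real.log (1/2) = - Real.log 2 := by rw [one_div, Real.log_inv]
    simp only [e, Li_zero, sub_zero, e2] at key h
    simp only [zero_mul] at key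
    linear_combination key - Real.log 2 * h
  · refine ((Li_cont.mono ?_).add (Li_cont.comp (by fun_prop) ?_)).sub
      (Real.continuous_mul_log.continuousOn.mul (SS_cont.mono ?_))
    · intro x hx; constructor <;> linarith [hx.1, hx.2]
    · intro x hx; constructor <;> linarith [hx.1, hx.2]
    · intro x hx; constructor <;> linarith [hx.1, hx.2]
  · intro x hx
    have hx0 : 0 < x := hx.1
    have hx1 : x < 1 := by linarith [hx.2]
    have hx2 : 0 < 1 - x := by linarith
    have a1 : |x| < 1 := abs_lt.2 ⟨by linarith, hx1⟩
    have d1 := Li_deriv' a1 hx0.ne'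
    have d2 := (Li_deriv' (z := 1 - x) (abs_lt.2 ⟨by linarith, by linarith⟩) hx2.ne').comp x
      ((hasDerivAt_id x).const_sub 1)
    have d3 := (Real.hasDerivAt_log hx0.ne').mul (((hasDerivAt_id x).const_sub 1).log hx2.ne')
    have d := (d1.add d2).add d3
    have d' := d.congr_of_eventuallyEq
      (f₁ := fun x => Li 2 x + Li 2 (1 - x) - (x * Real.log x) * SS x) ?_
    · refine d'.congr_deriv ?_
      simp only [id, sub_sub_cancel]
      field_simp
      ring
    · filter_upwards [isOpen_Ioo.mem_nhds hx] with y hy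
      have := SS_mul (z := y) (abs_lt.2 ⟨by linarith [hy.1], by linarith [hy.2]⟩)
      simp only [Pi.add_apply, Pi.mul_apply, Function.comp, id]
      linear_combination - Real.log y * this

theorem Li_landen : Li 2 (1/3) + Li 2 (-(1/2)) = - (1/2) * Real.log (2/3) ^ 2 := by
  have key := const_aux (f := fun x => Li 2 x + Li 2 (x / (x - 1)) + 1/2 * Real.log (1 - x) ^ 2)
    (a := 0) (b := 1/3) (by norm_num) ?_ ?_
  · norm_num [Li_zero] at key ⊢
    linarith
  · refine ((Li_cont.mono ?_).add (Li_cont.comp ?_ ?_)).add ?_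
    · intro x hx; constructor <;> linarith [hx.1, hx.2]
    · refine continuousOn_id.div (by fun_prop) ?_
      intro x hx; linarith [hx.2]
    · intro x hx
      have h := hx.1
      have h' := hx.2
      have : x - 1 < 0 := by linarith
      constructor
      · rw [le_div_iff_of_neg this]; linarith
      · rw [div_le_iff_of_neg this]; linarith
    · refine continuousOn_const.mul (ContinuousOn.pow (ContinuousOn.log (by fun_prop) ?_) 2)
      intro x hx; linarith [hx.2]
  · intro x hx
    have hx0 : 0 < x := hx.1
    have hx1 : x < 1/3 := hx.2
    have hx2 : 0 < 1 - x := by linarith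
    have hx3 : x - 1 < 0 := by linarith
    have d1 := Li_deriv' (z := x) (abs_lt.2 ⟨by linarith, by linarith⟩) hx0.ne'
    have d2 := (Li_deriv' (z := x / (x - 1)) (abs_lt.2 ⟨by rw [lt_div_iff_of_neg hx3]; linarith,
      by rw [div_lt_iff_of_neg hx3]; linarith⟩) (div_ne_zero hx0.ne' hx3.ne)).comp x
      ((hasDerivAt_id x).div ((hasDerivAt_id x).sub_const 1) hx3.ne)
    have d3 := ((((hasDerivAt_id x).const_sub 1).log hx2.ne').pow 2).const_mul (1/2)
    have d := (d1.add d2).add d3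
    refine d.congr_deriv ?_
    have e : (1 : ℝ) - x / (x - 1) = (1 - x)⁻¹ := by
      have := hx3.ne
      have := hx2.ne'
      field_simp
      ring
    simp only [id, e, Real.log_inv]
    have := hx3.ne
    have := hx2.ne'
    field_simp
    ring

theorem Li_quarter : Li 2 (1/4) = 2 * (Li 2 (1/2) + Li 2 (-(1/2))) := by
  have s1 := (Li_summable (z := 1/2) (by rw [abs_of_pos] <;> norm_num)).hasSum
  have s2 := (Li_summable (z := -(1/2)) (by rw [abs_neg, abs_of_pos] <;> norm_num)).hasSum
  have s := (s1.add s2).mul_left 2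
  have s3 := (Li_summable (z := 1/4) (by rw [abs_of_pos] <;> norm_num)).hasSum
  refine HasSum.unique s3 ?_ |>.trans rfl
  have hinj : Function.Injective (fun n : ℕ => 2 * n + 1) := by
    intro a b h; simp at h; exact h
  rw [← hinj.hasSum_iff] at s
  · refine (congrArg (fun f => HasSum f _) (funext fun n => ?_)).mp s
    simp only [Function.comp]
    have e1 : (-(1/2) : ℝ) ^ (2 * n + 1 + 1) = (1/4) ^ (n+1) := by
      rw [show 2 * n + 1 + 1 = 2 * (n+1) by ring, pow_mul]; norm_num
    have e2 : ((1/2) : ℝ) ^ (2 * n + 1 + 1) = (1/4) ^ (n+1) := by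
      rw [show 2 * n + 1 + 1 = 2 * (n+1) by ring, pow_mul]; norm_num
    rw [e1, e2]
    have : (n : ℝ) + 1 ≠ 0 := by positivity
    push_cast
    rw [show (2 * (n:ℝ) + 1 + 1) = 2 * (n + 1) by ring]
    field_simp
    try ring
  · intro n hn
    have : Even n := by
      by_contra h
      rw [Nat.not_even_iff_odd] at h
      obtain ⟨k, hk⟩ := h
      exact hn ⟨k, hk.symm⟩
    rw [this.add_one.neg_pow]
    ring

theorem P_aux
    (P : ℕ → ℝ → ℝ)
    (hP0 : ∀ u : ℝ, 0 ≤ u → P 0 u = 1)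
    (hPcont : ∀ k : ℕ, ContinuousOn (P (k + 1)) (Set.Ici ((k : ℝ) + 1)))
    (hPinit : ∀ k : ℕ, P (k + 1) ((k : ℝ) + 1) = 0)
    (hPderiv : ∀ k : ℕ, ∀ u : ℝ, (k : ℝ) + 1 < u →
      HasDerivAt (P (k + 1)) (P k (u - 1) / u) u) :
    P 2 3 = (1 / 2) * ((Real.log 3) ^ 2 - zeta' 2) + Li 2 (1 / 3) := by
  have hP1 : ∀ u : ℝ, 1 < u → P 1 u = Real.log u := by
    intro u hu
    have c := hPcont 0
    have i := hPinit 0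
    have d := hPderiv 0
    simp only [Nat.cast_zero, zero_add] at c i d
    have key := const_aux (f := fun x => P 1 x - Real.log x) hu ?_ ?_
    · simp only [i, Real.log_one] at key; linarith
    · refine (c.mono Set.Icc_subset_Ici_self).sub (Real.continuousOn_log.mono ?_)
      intro x hx
      have := hx.1
      simp; linarith
    · intro x hx
      have hx1 := hx.1
      refine ((d x hx.1).sub (Real.hasDerivAt_log (by linarith : x ≠ 0))).congr_deriv ?_
      rw [hP0 _ (by linarith)]; ring
  have c := hPcont 1
  have i := hPinit 1
  have d := hPderiv 1
  norm_num only at c i d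
  have key := const_aux
    (f := fun x => P 2 x - (1 / 2 * (Real.log x ^ 2 - zeta' 2) + Li 2 x⁻¹))
    (a := 2) (b := 3) (by norm_num) ?_ ?_
  · have h := Li_half
    norm_num only [i, zeta'] at key h ⊢
    linarith
  · refine (c.mono Set.Icc_subset_Ici_self).sub (ContinuousOn.add (continuousOn_const.mul
      (ContinuousOn.sub (ContinuousOn.pow (Real.continuousOn_log.mono ?_) 2) continuousOn_const))
      (Li_cont.comp (continuousOn_id.inv₀ ?_) ?_))
    · intro x hx
      have := hx.1
      simp; linarith
    · intro x hx
      have := hx.1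
      simp; linarith
    · intro x hx
      have := hx.1
      have h0 : 0 < x⁻¹ := by positivity
      have h1 : x⁻¹ ≤ 1 := inv_le_one_of_one_le₀ (by linarith)
      exact ⟨(by linarith : (-1:ℝ) ≤ x⁻¹), h1⟩
  · intro x hx
    have hx1 := hx.1
    have hx0 : 0 < x := by linarith
    have h0 : 0 < x⁻¹ := by positivity
    have h1 : x⁻¹ < 1 := inv_lt_one_of_one_lt₀ (by linarith)
    have d2 := (Li_deriv' (z := x⁻¹) (abs_lt.2 ⟨by linarith, h1⟩) h0.ne').comp x
      (hasDerivAt_inv hx0.ne')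
    have d1 := (((Real.hasDerivAt_log hx0.ne').pow 2).sub_const (zeta' 2)).const_mul (1/2)
    refine ((d x hx1).sub (d1.add d2)).congr_deriv ?_
    rw [hP1 _ (by linarith), show 1 - x⁻¹ = (x - 1) / x by field_simp,
      Real.log_div (by linarith) hx0.ne']
    field_simp
    ring

/-- The dilogarithm identity
`½·(log²(3) − ζ(2)) + Li₂(1/3) = log(2)·log(3/2) − ½·Li₂(1/4)` holds; equivalently,
the Furry probability of weight two satisfies `P₂(3) = log(2)·log(3/2) − ½·Li₂(1/4)`. -/
theorem furry_dilog_identity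
    (P : ℕ → ℝ → ℝ)
    (hP0 : ∀ u : ℝ, 0 ≤ u → P 0 u = 1)
    (hPcont : ∀ k : ℕ, ContinuousOn (P (k + 1)) (Set.Ici ((k : ℝ) + 1)))
    (hPinit : ∀ k : ℕ, P (k + 1) ((k : ℝ) + 1) = 0)
    (hPderiv : ∀ k : ℕ, ∀ u : ℝ, (k : ℝ) + 1 < u →
      HasDerivAt (P (k + 1)) (P k (u - 1) / u) u) :
    ((1 / 2) * ((Real.log 3) ^ 2 - zeta' 2) + Li 2 (1 / 3)
        = Real.log 2 * Real.log (3 / 2) - (1 / 2) * Li 2 (1 / 4)) ∧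
    P 2 3 = Real.log 2 * Real.log (3 / 2) - (1 / 2) * Li 2 (1 / 4) := by
  have h : (1 / 2) * ((Real.log 3) ^ 2 - zeta' 2) + Li 2 (1 / 3)
        = Real.log 2 * Real.log (3 / 2) - (1 / 2) * Li 2 (1 / 4) := by
    have h1 := Li_half
    have h2 := Li_landen
    have h3 := Li_quarter
    rw [Real.log_div (by norm_num) (by norm_num)] at h2 ⊢
    unfold zeta'
    linear_combination h2 + h3 / 2 + h1 / 2
  exact ⟨h, (P_aux P hP0 hPcont hPinit hPderiv).trans h⟩
end

section
/- For every real u > 2, the dilogarithm combination A_2(u) = Li_2(1/(u+1)) + Li_2(1/(1−u)) − (1/2)·Li_2(1/(1−u²)) + (1/4)·log²((u−1)/(u+1)) vanishes identically: A_2(u) = 0. -/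
/-- The classical dilogarithm `Li₂(z) = ∑_{n≥1} z^n/n²`. -/
noncomputable def Li2 (z : ℝ) : ℝ :=
  ∑' n : ℕ, z ^ (n + 1) / ((n : ℝ) + 1) ^ 2

lemma Li2_aux {z : ℝ} (hz : |z| < 1) :
    HasDerivAt Li2 (∑' n : ℕ, z ^ n / ((n : ℝ) + 1)) z := by
  obtain ⟨r, hr, hr1⟩ := exists_between hz
  have hr0 : 0 < r := (abs_nonneg z).trans_lt hr
  unfold Li2
  refine hasDerivAt_tsum_of_isPreconnected (𝕜 := ℝ) (u := fun n : ℕ => r ^ n)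
    (t := Metric.ball (0 : ℝ) r) (y₀ := 0)
    (g := fun (n : ℕ) (z : ℝ) => z ^ (n + 1) / ((n : ℝ) + 1) ^ 2)
    (g' := fun (n : ℕ) (z : ℝ) => z ^ n / ((n : ℝ) + 1))
    (summable_geometric_of_lt_one hr0.le hr1) Metric.isOpen_ball
    (convex_ball _ _).isPreconnected ?_ ?_ ?_ ?_ ?_
  · intro n y _
    have h := (hasDerivAt_pow (n + 1) y).div_const (((n : ℝ) + 1) ^ 2)
    convert! h using 1
    have : (n : ℝ) + 1 ≠ 0 := by positivity
    push_cast
    field_simp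
  · intro n y hy
    have hy' : |y| < r := by simpa using hy
    have h1 : (1 : ℝ) ≤ (n : ℝ) + 1 := by
      have : (0 : ℝ) ≤ n := by positivity
      linarith
    rw [Real.norm_eq_abs, abs_div, abs_pow, abs_of_pos (by linarith : (0 : ℝ) < (n : ℝ) + 1)]
    exact (div_le_self (by positivity) h1).trans (pow_le_pow_left₀ (abs_nonneg _) hy'.le n)
  · simpa using hr0
  · simpa using summable_zero
  · simpa using hr

lemma Li2_deriv {z : ℝ} (hz : |z| < 1) (h0 : z ≠ 0) :
    HasDerivAt Li2 (-Real.log (1 - z) / z) z := by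
  have h := Li2_aux hz
  have h2 := (Real.hasSum_pow_div_log_of_abs_lt_one hz).div_const z
  convert! h using 1
  rw [← h2.tsum_eq]
  congr 1
  ext n
  field_simp
  ring

lemma Li2_tendsto {f : ℝ → ℝ} (hf : Filter.Tendsto f Filter.atTop (nhds 0)) :
    Filter.Tendsto (fun u => Li2 (f u)) Filter.atTop (nhds 0) := by
  have h0 : Li2 0 = 0 := by simp [Li2]
  have h := (Li2_aux (z := 0) (by simp)).continuousAt.tendsto
  rw [h0] at h
  exact h.comp hf

lemma comb_deriv {u : ℝ} (hu : 2 < u) : HasDerivAt (fun u : ℝ =>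
      Li2 (1 / (u + 1)) + Li2 (1 / (1 - u)) - (1 / 2) * Li2 (1 / (1 - u ^ 2))
        + (1 / 4) * (Real.log ((u - 1) / (u + 1))) ^ 2) 0 u := by
  have p1 : 0 < u + 1 := by linarith
  have p2 : 0 < u - 1 := by linarith
  have p0 : 0 < u := by linarith
  have p3 : 0 < u ^ 2 - 1 := by nlinarith
  have n2 : 1 - u ≠ 0 := by linarith
  have n3 : 1 - u ^ 2 ≠ 0 := by linarith
  have a1 : |1 / (u + 1)| < 1 := by
    rw [abs_div, abs_one, abs_of_pos p1, div_lt_one p1]; linarith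
  have a2 : |1 / (1 - u)| < 1 := by
    rw [abs_div, abs_one, abs_sub_comm, abs_of_pos p2, div_lt_one p2]; linarith
  have a3 : |1 / (1 - u ^ 2)| < 1 := by
    rw [abs_div, abs_one, abs_sub_comm, abs_of_pos p3, div_lt_one p3]; nlinarith
  have d1 : HasDerivAt (fun u : ℝ => 1 / (u + 1)) (-1 / (u + 1) ^ 2) u := by
    simpa using ((hasDerivAt_id u).add_const 1).fun_inv p1.ne'
  have d2 : HasDerivAt (fun u : ℝ => 1 / (1 - u)) (1 / (1 - u) ^ 2) u := by
    simpa using ((hasDerivAt_id u).const_sub 1).fun_inv n2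
  have d3 : HasDerivAt (fun u : ℝ => 1 / (1 - u ^ 2)) (2 * u / (1 - u ^ 2) ^ 2) u := by
    simpa using ((hasDerivAt_pow 2 u).const_sub 1).fun_inv n3
  have d4 : HasDerivAt (fun u : ℝ => (u - 1) / (u + 1))
      ((1 * (u + 1) - (u - 1) * 1) / (u + 1) ^ 2) u :=
    ((hasDerivAt_id u).sub_const 1).fun_div ((hasDerivAt_id u).add_const 1) p1.ne'
  have e1 := (Li2_deriv a1 (by positivity)).comp u d1
  have e2 := (Li2_deriv a2 (one_div_ne_zero n2)).comp u d2
  have e3 := (Li2_deriv a3 (one_div_ne_zero n3)).comp u d3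
  have e4 := (d4.log (div_pos p2 p1).ne').fun_pow 2
  have e := ((e1.add e2).sub (e3.const_mul (1 / 2))).add (e4.const_mul (1 / 4))
  have l1 : Real.log (1 - 1 / (u + 1)) = Real.log u - Real.log (u + 1) := by
    rw [← Real.log_div p0.ne' p1.ne']; congr 1; field_simp; ring
  have l2 : Real.log (1 - 1 / (1 - u)) = Real.log u - Real.log (u - 1) := by
    rw [← Real.log_div p0.ne' p2.ne']; congr 1
    have := p2.ne'
    rw [← neg_sub u 1]; field_simp; ring
  have l3 : Real.log (1 - 1 / (1 - u ^ 2))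
      = 2 * Real.log u - Real.log (u - 1) - Real.log (u + 1) := by
    have : 1 - 1 / (1 - u ^ 2) = u ^ 2 / ((u - 1) * (u + 1)) := by
      have := p2.ne'
      have := p1.ne'
      rw [show 1 - u ^ 2 = -((u - 1) * (u + 1)) by ring]; field_simp; ring
    rw [this, Real.log_div (by positivity) (by positivity), Real.log_mul p2.ne' p1.ne',
      Real.log_pow]
    push_cast; ring
  rw [l1, l2, l3, Real.log_div p2.ne' p1.ne'] at e
  refine e.congr_deriv ?_
  generalize Real.log u = L
  generalize Real.log (u + 1) = b
  generalize Real.log (u - 1) = a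
  have := p2.ne'
  have := p1.ne'
  rw [show 1 - u ^ 2 = -((u - 1) * (u + 1)) by ring, ← neg_sub u 1]
  field_simp
  ring

theorem dilog_combination_vanishes :
    ∀ u : ℝ, 2 < u →
      Li2 (1 / (u + 1)) + Li2 (1 / (1 - u)) - (1 / 2) * Li2 (1 / (1 - u ^ 2))
        + (1 / 4) * (Real.log ((u - 1) / (u + 1))) ^ 2 = 0 := by
  intro u hu
  have t1 : Filter.Tendsto (fun u : ℝ => 1 / (u + 1)) Filter.atTop (nhds 0) := by
    simp only [one_div]
    exact tendsto_inv_atTop_zero.comp (Filter.tendsto_atTop_add_const_right _ _ Filter.tendsto_id)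
  have t2 : Filter.Tendsto (fun u : ℝ => 1 / (1 - u)) Filter.atTop (nhds 0) := by
    simp only [one_div]
    refine tendsto_inv_atBot_zero.comp ?_
    exact Filter.tendsto_atBot_add_const_left _ 1 Filter.tendsto_neg_atTop_atBot
  have t3 : Filter.Tendsto (fun u : ℝ => 1 / (1 - u ^ 2)) Filter.atTop (nhds 0) := by
    simp only [one_div]
    refine tendsto_inv_atBot_zero.comp ?_
    exact Filter.tendsto_atBot_add_const_left _ 1
      (Filter.tendsto_neg_atTop_atBot.comp (Filter.tendsto_pow_atTop two_ne_zero))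
  have t4 : Filter.Tendsto (fun u : ℝ => (u - 1) / (u + 1)) Filter.atTop (nhds 1) := by
    have h : Filter.Tendsto (fun u : ℝ => 1 - 2 * (1 / (u + 1))) Filter.atTop (nhds 1) := by
      simpa using (t1.const_mul 2).const_sub 1
    refine h.congr' ?_
    filter_upwards [Filter.eventually_gt_atTop 0] with x hx
    field_simp
    ring
  have t5 := ((Real.continuousAt_log one_ne_zero).tendsto.comp t4).pow 2
  have t := (((Li2_tendsto t1).add (Li2_tendsto t2)).sub
    ((Li2_tendsto t3).const_mul (1 / 2))).add (t5.const_mul (1 / 4))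
  simp only [Real.log_one, Function.comp_apply] at t
  norm_num only at t
  refine tendsto_nhds_unique (Filter.Tendsto.congr' ?_ tendsto_const_nhds) t
  filter_upwards [Filter.eventually_gt_atTop 2] with x hx
  have := isOpen_Ioi.is_const_of_deriv_eq_zero (convex_Ioi (2 : ℝ)).isPreconnected
    (fun y hy => (comb_deriv hy).differentiableAt.differentiableWithinAt)
    (fun y hy => (comb_deriv hy).deriv) hu hx
  exact this
end
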